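/- Let Σ be a finite set of points in ℙⁿ (n ≥ 2) over ℂ and μ ≥ 2 a natural number such that |Σ| ≤ μ² − 1 and for each k = 1, …, μ−1 at most μk points of Σ lie on a curve of degree k in ℙⁿ. Then Σ imposes independent linear conditions on homogeneous forms of degree 2μ − 3, i.e., for every point P ∈ Σ there exists a homogeneous form of degree 2μ − 3 vanishing at all points of Σ ∖ {P} but not at P. -/

import Mathlib

open MvPolynomial

noncomputable section

/-- Complex projective n-space. -/
abbrev Pt (n : ℕ) := Projectivization ℂ (Fin (n+1) → ℂ)

/-- A homogeneous form vanishes at a point of projective space. -/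
def VanishesAt {n : ℕ} (F : MvPolynomial (Fin (n+1)) ℂ) (p : Pt n) : Prop :=
  ∀ (v : Fin (n+1) → ℂ) (hv : v ≠ 0), p = Projectivization.mk ℂ v hv → eval v F = 0

/-- The common zero locus of a set of forms. -/
def ZeroLocus {n : ℕ} (S : Set (MvPolynomial (Fin (n+1)) ℂ)) : Set (Pt n) :=
  {p | ∀ F ∈ S, VanishesAt F p}

/-- An algebraic subset of projective space: the zero locus of a set of homogeneous forms. -/
def IsAlgebraicSet {n : ℕ} (C : Set (Pt n)) : Prop :=
  ∃ S : Set (MvPolynomial (Fin (n+1)) ℂ),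
    (∀ F ∈ S, ∃ d, F.IsHomogeneous d) ∧ C = ZeroLocus S

/-- An irreducible algebraic set. -/
def IsIrreducibleAlgSet {n : ℕ} (C : Set (Pt n)) : Prop :=
  IsAlgebraicSet C ∧ C.Nonempty ∧
    ∀ A B : Set (Pt n), IsAlgebraicSet A → IsAlgebraicSet B → C ⊆ A ∪ B → C ⊆ A ∨ C ⊆ B

/-- A curve: an irreducible reduced one-dimensional closed subvariety, characterized as an
infinite irreducible algebraic set all of whose proper algebraic subsets are finite. -/
def IsCurve {n : ℕ} (C : Set (Pt n)) : Prop :=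
  IsIrreducibleAlgSet C ∧ C.Infinite ∧
    ∀ A : Set (Pt n), IsAlgebraicSet A → A ⊆ C → A ≠ C → A.Finite

/-- A curve of degree `k`: every hyperplane not containing it meets it in at most `k` points,
and some hyperplane meets it in exactly `k` points. -/
def IsCurveOfDegree {n : ℕ} (C : Set (Pt n)) (k : ℕ) : Prop :=
  IsCurve C ∧
  (∀ F : MvPolynomial (Fin (n+1)) ℂ, F ≠ 0 → F.IsHomogeneous 1 →
      ¬ C ⊆ ZeroLocus {F} → (C ∩ ZeroLocus {F}).ncard ≤ k) ∧
  (∃ F : MvPolynomial (Fin (n+1)) ℂ, F ≠ 0 ∧ F.IsHomogeneous 1 ∧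
      ¬ C ⊆ ZeroLocus {F} ∧ (C ∩ ZeroLocus {F}).ncard = k)

/-- A finite set imposes independent linear conditions on forms of degree `D`. -/
def ImposesIndependentConditions {n : ℕ} (S : Finset (Pt n)) (D : ℕ) : Prop :=
  ∀ P ∈ S, ∃ F : MvPolynomial (Fin (n+1)) ℂ, F.IsHomogeneous D ∧
    (∀ Q ∈ S, Q ≠ P → VanishesAt F Q) ∧ ¬ VanishesAt F P

/-! ### A hyperplane restriction theorem -/

open Module in
/-- If `P` is surjective onto a finite-dimensional space, so is some perturbation `P + s • Q`. -/
lemma exists_ne_zero_surjective_add_smul {X K : Type*} [AddCommGroup X] [Module ℂ X]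
    [AddCommGroup K] [Module ℂ K] [FiniteDimensional ℂ K] (P Q : X →ₗ[ℂ] K)
    (hP : Function.Surjective P) :
    ∃ s : ℂ, s ≠ 0 ∧ Function.Surjective (P + s • Q) := by
  obtain ⟨σ, hσ⟩ := P.exists_rightInverse_of_surjective (LinearMap.range_eq_top.2 hP)
  have hfin : {c | Module.End.HasEigenvalue (Q ∘ₗ σ : Module.End ℂ K) c}.Finite :=
    Module.End.finite_hasEigenvalue _
  obtain ⟨c, hc⟩ := (hfin.union (Set.finite_singleton (0 : ℂ))).exists_notMem
  simp only [Set.mem_union, Set.mem_ofPred_eq, Set.mem_singleton_iff, not_or] at hc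
  obtain ⟨hc, hc0⟩ := hc
  refine ⟨-c⁻¹, by simpa using hc0, ?_⟩
  have hinj : Function.Injective ((P + (-c⁻¹) • Q) ∘ₗ σ) := by
    rw [← LinearMap.ker_eq_bot, LinearMap.ker_eq_bot']
    intro x hx
    by_contra hx0
    apply hc
    refine Module.End.hasEigenvalue_of_hasEigenvector (x := x) ⟨?_, hx0⟩
    rw [Module.End.mem_eigenspace_iff]
    have h1 : P (σ x) = x := LinearMap.congr_fun hσ x
    simp only [LinearMap.comp_apply, LinearMap.add_apply, LinearMap.smul_apply, h1] at hx
    have : c • (x + -c⁻¹ • Q (σ x)) = 0 := by rw [hx, smul_zero]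
    rw [smul_add, smul_smul, mul_neg, mul_inv_cancel₀ hc0, neg_one_smul, ← sub_eq_add_neg,
      sub_eq_zero] at this
    exact this.symm
  have hsurj := LinearMap.injective_iff_surjective.1 hinj
  intro y
  obtain ⟨x, hx⟩ := hsurj y
  exact ⟨σ x, hx⟩

section Green

variable {A V : Type*} [CommRing A] [Algebra ℂ A] [AddCommGroup V] [Module ℂ V]

/-- The image of `e * W ^ j` under a linear map. -/
def mulPowImage (W : Submodule ℂ A) (π : A →ₗ[ℂ] V) (e : A) (j : ℕ) : Submodule ℂ V :=
  (W ^ j).map (π ∘ₗ LinearMap.mulLeft ℂ e)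

lemma mulPowImage_finiteDimensional (W : Submodule ℂ A) [FiniteDimensional ℂ W]
    (π : A →ₗ[ℂ] V) (e : A) (j : ℕ) : FiniteDimensional ℂ (mulPowImage W π e j) := by
  have h : (W ^ j).FG := Submodule.FG.pow (Module.Finite.iff_fg.1 inferInstance) j
  exact Module.Finite.iff_fg.2 (h.map _)

lemma mem_mulPowImage {W : Submodule ℂ A} {π : A →ₗ[ℂ] V} {e : A} {j : ℕ} {x : V} :
    x ∈ mulPowImage W π e j ↔ ∃ F ∈ W ^ j, π (e * F) = x := by
  simp [mulPowImage]

lemma mulPowImage_mul_le {W : Submodule ℂ A} (π : A →ₗ[ℂ] V) (e : A) (j : ℕ) {m : A}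
    (hm : m ∈ W) : mulPowImage W π (e * m) j ≤ mulPowImage W π e (j + 1) := by
  intro x hx
  obtain ⟨F, hF, rfl⟩ := mem_mulPowImage.1 hx
  refine mem_mulPowImage.2 ⟨m * F, ?_, by rw [mul_assoc]⟩
  rw [pow_succ']
  exact Submodule.mul_mem_mul hm hF

lemma mulPowImage_succ_le {W : Submodule ℂ A} {π : A →ₗ[ℂ] V} {e : A} {j : ℕ}
    {K : Submodule ℂ V} (h : ∀ y ∈ W, mulPowImage W π (e * y) j ≤ K) :
    mulPowImage W π e (j + 1) ≤ K := by
  intro x hx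
  obtain ⟨F, hF, rfl⟩ := mem_mulPowImage.1 hx
  rw [pow_succ'] at hF
  induction hF using Submodule.mul_induction_on' with
  | mem_mul_mem y hy G hG => exact h y hy (mem_mulPowImage.2 ⟨G, hG, by rw [mul_assoc]⟩)
  | add F _ G _ hF hG =>
    rw [mul_add, map_add]
    exact K.add_mem (hF (mem_mulPowImage.2 ⟨_, by rwa [pow_succ'], rfl⟩))
      (hG (mem_mulPowImage.2 ⟨_, by rwa [pow_succ'], rfl⟩))

open Module in
/-- A form of Green's hyperplane restriction theorem: if the degree `j + 1` part of a standard
graded algebra has dimension at most `j + 1`, some linear form maps the degree `j` part onto it. -/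
theorem exists_mulPowImage_eq (W : Submodule ℂ A) [FiniteDimensional ℂ W] (π : A →ₗ[ℂ] V)
    (j : ℕ) (e : A) (h : finrank ℂ (mulPowImage W π e (j + 1)) ≤ j + 1) :
    ∃ m ∈ W, mulPowImage W π e (j + 1) = mulPowImage W π (e * m) j := by
  have := mulPowImage_finiteDimensional W π
  induction j generalizing e with
  | zero =>
    obtain ⟨⟨v, hv⟩, hspan⟩ := finrank_le_one_iff.1 h
    obtain ⟨m, hm, rfl⟩ := mem_mulPowImage.1 hv
    rw [zero_add, pow_one] at hm
    refine ⟨m, hm, le_antisymm ?_ (mulPowImage_mul_le π e 0 hm)⟩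
    intro x hx
    obtain ⟨c, hc⟩ := hspan ⟨x, hx⟩
    have hc' : c • π (e * m) = x := congrArg Subtype.val hc
    refine mem_mulPowImage.2 ⟨c • 1, ?_, ?_⟩
    · rw [pow_zero]
      exact Submodule.smul_mem _ _ (Submodule.one_le.1 le_rfl)
    · rw [mul_smul_comm, mul_one, map_smul, hc']
  | succ j ih =>
    let s : Set ℕ := {r | ∃ m ∈ W, finrank ℂ (mulPowImage W π (e * m) (j + 1)) = r}
    have hs : s.Nonempty := ⟨_, 0, W.zero_mem, rfl⟩
    have hle : ∀ m ∈ W, finrank ℂ (mulPowImage W π (e * m) (j + 1)) ≤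
        finrank ℂ (mulPowImage W π e (j + 1 + 1)) := fun m hm =>
      Submodule.finrank_mono (mulPowImage_mul_le π e _ hm)
    have hbdd : BddAbove s := by
      refine ⟨finrank ℂ (mulPowImage W π e (j + 1 + 1)), ?_⟩
      rintro _ ⟨m, hm, rfl⟩
      exact hle m hm
    obtain ⟨m, hm, hmr⟩ := Nat.sSup_mem hs hbdd
    have hmax : ∀ y ∈ W, finrank ℂ (mulPowImage W π (e * y) (j + 1)) ≤
        finrank ℂ (mulPowImage W π (e * m) (j + 1)) := fun y hy => by
      rw [hmr]; exact le_csSup hbdd ⟨y, hy, rfl⟩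
    refine ⟨m, hm, ?_⟩
    rcases (hle m hm).eq_or_lt with heq | hlt
    · exact (Submodule.eq_of_le_of_finrank_eq (mulPowImage_mul_le π e _ hm) heq).symm
    obtain ⟨m', hm', hK⟩ := ih (e * m) (by omega)
    refine le_antisymm (mulPowImage_succ_le fun y hy => ?_) (mulPowImage_mul_le π e _ hm)
    set K := mulPowImage W π (e * m) (j + 1) with hKdef
    have hQmem : ∀ F : ↥(W ^ j), (π ∘ₗ LinearMap.mulLeft ℂ (e * m * y) ∘ₗ (W ^ j).subtype) F ∈ K :=
      fun F => mulPowImage_mul_le π (e * m) j hy (mem_mulPowImage.2 ⟨F, F.2, rfl⟩)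
    have hPmem : ∀ F : ↥(W ^ j), (π ∘ₗ LinearMap.mulLeft ℂ (e * m * m') ∘ₗ (W ^ j).subtype) F ∈ K :=
      fun F => mulPowImage_mul_le π (e * m) j hm' (mem_mulPowImage.2 ⟨F, F.2, rfl⟩)
    obtain ⟨c, hc0, hsurj⟩ := exists_ne_zero_surjective_add_smul
      (LinearMap.codRestrict K _ hPmem) (LinearMap.codRestrict K _ hQmem) (by
        rintro ⟨x, hx⟩
        obtain ⟨F, hF, rfl⟩ := mem_mulPowImage.1 (hK ▸ hx)
        exact ⟨⟨F, hF⟩, rfl⟩)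
    have key : ∀ w ∈ W, K ≤ mulPowImage W π (e * m * w) j →
        mulPowImage W π (e * w) (j + 1) = K := by
      intro w hw hKw
      refine (Submodule.eq_of_le_of_finrank_le ?_ (hmax w hw)).symm
      refine hKw.trans ?_
      rw [mul_right_comm]
      exact mulPowImage_mul_le π (e * w) j hm
    have h1 := key m' hm' hK.le
    have h2 := key (m' + c • y) (W.add_mem hm' (W.smul_mem c hy)) (by
      intro x hx
      obtain ⟨F, hF⟩ := hsurj ⟨x, hx⟩
      refine mem_mulPowImage.2 ⟨F, F.2, ?_⟩
      have := congrArg Subtype.val hF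
      simp only [LinearMap.add_apply, LinearMap.smul_apply, Submodule.coe_add,
        Submodule.coe_smul, LinearMap.codRestrict_apply, LinearMap.comp_apply,
        Submodule.subtype_apply, LinearMap.mulLeft_apply] at this
      rw [← this, ← map_smul, ← map_add, mul_add, add_mul, mul_smul_comm, smul_mul_assoc])
    intro x hx
    obtain ⟨F, hF, rfl⟩ := mem_mulPowImage.1 hx
    have h3 : π (e * (m' + c • y) * F) ∈ K := h2 ▸ mem_mulPowImage.2 ⟨F, hF, rfl⟩
    have h4 : π (e * m' * F) ∈ K := h1 ▸ mem_mulPowImage.2 ⟨F, hF, rfl⟩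
    rw [mul_add, add_mul, map_add, mul_smul_comm, smul_mul_assoc, map_smul,
      Submodule.add_mem_iff_right _ h4] at h3
    exact (Submodule.smul_mem_iff _ hc0).1 h3

end Green

/-! ### Growth of the powers of a subspace of an algebra -/

open Module in
lemma finrank_map_add_finrank_inf_ker {V V' : Type*} [AddCommGroup V] [Module ℂ V]
    [AddCommGroup V'] [Module ℂ V'] (f : V →ₗ[ℂ] V') (N : Submodule ℂ V)
    [FiniteDimensional ℂ N] :
    finrank ℂ (N.map f) + finrank ℂ ↥(N ⊓ LinearMap.ker f) = finrank ℂ N := by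
  have h := LinearMap.finrank_range_add_finrank_ker (f ∘ₗ N.subtype)
  rw [LinearMap.range_comp, Submodule.range_subtype, LinearMap.ker_comp] at h
  rw [← h]
  congr 1
  rw [← Submodule.map_comap_subtype]
  exact (Submodule.equivSubtypeMap N _).finrank_eq.symm

section Growth

open Module

variable {A : Type*} [CommRing A] [Algebra ℂ A] {W : Submodule ℂ A}

lemma pow_le_pow_succ_of_one_mem (h1 : (1 : A) ∈ W) (t : ℕ) : W ^ t ≤ W ^ (t + 1) := by
  intro x hx
  rw [pow_succ, ← mul_one x]
  exact Submodule.mul_mem_mul hx h1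

lemma one_mem_pow_of_one_mem (h1 : (1 : A) ∈ W) (t : ℕ) : (1 : A) ∈ W ^ t := by
  simpa using Submodule.pow_mem_pow W h1 t

lemma pow_succ_succ_eq_sup {t : ℕ} {m : A} (h1 : (1 : A) ∈ W) (hm : m ∈ W)
    (h : W ^ (t + 1) = W ^ t ⊔ (W ^ t).map (LinearMap.mulLeft ℂ m)) :
    W ^ (t + 2) = W ^ (t + 1) ⊔ (W ^ (t + 1)).map (LinearMap.mulLeft ℂ m) := by
  refine le_antisymm ?_ (sup_le (pow_le_pow_succ_of_one_mem h1 _) ?_)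
  · rw [pow_succ' W (t + 1), Submodule.mul_le]
    intro w hw x hx
    rw [h] at hx
    obtain ⟨f, hf, _, ⟨g, hg, rfl⟩, rfl⟩ := Submodule.mem_sup.1 hx
    rw [mul_add]
    refine Submodule.add_mem_sup ?_ ⟨w * g, ?_, ?_⟩
    · rw [pow_succ']; exact Submodule.mul_mem_mul hw hf
    · rw [pow_succ']; exact Submodule.mul_mem_mul hw hg
    · simp only [LinearMap.mulLeft_apply]; ring
  · rintro _ ⟨f, hf, rfl⟩
    rw [pow_succ' W (t + 1)]
    exact Submodule.mul_mem_mul hm hf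

lemma pow_le_inf_ker {t : ℕ} {m : A} (h1 : (1 : A) ∈ W) (hm : m ∈ W) :
    W ^ t ≤ W ^ (t + 1) ⊓ LinearMap.ker ((W ^ (t + 1)).mkQ ∘ₗ LinearMap.mulLeft ℂ m) := by
  refine le_inf (pow_le_pow_succ_of_one_mem h1 t) fun x hx => ?_
  rw [LinearMap.mem_ker, LinearMap.comp_apply, Submodule.mkQ_apply,
    Submodule.Quotient.mk_eq_zero, pow_succ']
  exact Submodule.mul_mem_mul hm hx

variable [FiniteDimensional ℂ A]

lemma finrank_map_mkQ_add {p N : Submodule ℂ A} (h : p ≤ N) :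
    finrank ℂ (N.map p.mkQ) + finrank ℂ p = finrank ℂ N := by
  have := finrank_map_add_finrank_inf_ker p.mkQ N
  rwa [Submodule.ker_mkQ, inf_eq_right.2 h] at this

/-- Small growth of the filtration `W ^ t` forces `W ^ (t + 1)` to be generated over `W ^ t` by a
single multiplication. -/
lemma exists_pow_succ_eq_sup (h1 : (1 : A) ∈ W) {t : ℕ}
    (h : finrank ℂ ↥(W ^ (t + 1)) ≤ finrank ℂ ↥(W ^ t) + (t + 1)) :
    ∃ m ∈ W, W ^ (t + 1) = W ^ t ⊔ (W ^ t).map (LinearMap.mulLeft ℂ m) := by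
  have hle := pow_le_pow_succ_of_one_mem h1 t
  have hmap : ∀ j, mulPowImage W (W ^ t).mkQ 1 j = (W ^ j).map (W ^ t).mkQ := by
    intro j
    simp [mulPowImage]
  obtain ⟨m, hm, heq⟩ := exists_mulPowImage_eq W (W ^ t).mkQ t 1 (by
    rw [hmap]
    have := finrank_map_mkQ_add hle
    omega)
  refine ⟨m, hm, ?_⟩
  rw [hmap, one_mul, mulPowImage, Submodule.map_comp] at heq
  have := congrArg (Submodule.comap (W ^ t).mkQ) heq
  rwa [Submodule.comap_map_mkQ, Submodule.comap_map_mkQ, sup_eq_right.2 hle] at this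

lemma finrank_pow_add_finrank_inf_ker {t : ℕ} {m : A} (h1 : (1 : A) ∈ W) (hm : m ∈ W)
    (h : W ^ (t + 1) = W ^ t ⊔ (W ^ t).map (LinearMap.mulLeft ℂ m)) :
    finrank ℂ ↥(W ^ (t + 2)) + finrank ℂ ↥(W ^ (t + 1) ⊓
      LinearMap.ker ((W ^ (t + 1)).mkQ ∘ₗ LinearMap.mulLeft ℂ m)) =
      2 * finrank ℂ ↥(W ^ (t + 1)) := by
  have h2 := finrank_map_add_finrank_inf_ker ((W ^ (t + 1)).mkQ ∘ₗ LinearMap.mulLeft ℂ m)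
    (W ^ (t + 1))
  have h3 := finrank_map_mkQ_add (pow_le_pow_succ_of_one_mem h1 (t + 1))
  have h4 : (W ^ (t + 1 + 1)).map (W ^ (t + 1)).mkQ =
      (W ^ (t + 1)).map ((W ^ (t + 1)).mkQ ∘ₗ LinearMap.mulLeft ℂ m) := by
    rw [pow_succ_succ_eq_sup h1 hm h, Submodule.map_sup, Submodule.mkQ_map_self, bot_sup_eq,
      Submodule.map_comp]
  rw [← h4] at h2
  change finrank ℂ ↥(W ^ (t + 1 + 1)) + _ = _
  omega

/-- Once the increment of `finrank (W ^ t)` drops to at most `t + 1`, the increments decrease. -/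
lemma finrank_pow_concave (h1 : (1 : A) ∈ W) {t : ℕ}
    (h : finrank ℂ ↥(W ^ (t + 1)) ≤ finrank ℂ ↥(W ^ t) + (t + 1)) :
    finrank ℂ ↥(W ^ (t + 2)) + finrank ℂ ↥(W ^ t) ≤ 2 * finrank ℂ ↥(W ^ (t + 1)) := by
  obtain ⟨m, hm, heq⟩ := exists_pow_succ_eq_sup h1 h
  have h2 := finrank_pow_add_finrank_inf_ker h1 hm heq
  have h3 := Submodule.finrank_mono (pow_le_inf_ker (t := t) h1 hm)
  omega

/-- If two consecutive increments of `finrank (W ^ t)` agree and are small, some `m ∈ W` induces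
an isomorphism between the corresponding graded pieces. -/
lemma exists_mul_iso_of_flat (h1 : (1 : A) ∈ W) {t : ℕ}
    (h : finrank ℂ ↥(W ^ (t + 1)) ≤ finrank ℂ ↥(W ^ t) + (t + 1))
    (hflat : finrank ℂ ↥(W ^ (t + 2)) + finrank ℂ ↥(W ^ t) = 2 * finrank ℂ ↥(W ^ (t + 1))) :
    ∃ m ∈ W, W ^ (t + 1) = W ^ t ⊔ (W ^ t).map (LinearMap.mulLeft ℂ m) ∧
      ∀ f ∈ W ^ (t + 1), m * f ∈ W ^ (t + 1) → f ∈ W ^ t := by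
  obtain ⟨m, hm, heq⟩ := exists_pow_succ_eq_sup h1 h
  refine ⟨m, hm, heq, fun f hf hmf => ?_⟩
  have h2 := finrank_pow_add_finrank_inf_ker h1 hm heq
  have h3 := Submodule.eq_of_le_of_finrank_le (pow_le_inf_ker (t := t) h1 hm) (by omega)
  rw [h3]
  refine ⟨hf, ?_⟩
  rw [SetLike.mem_coe, LinearMap.mem_ker, LinearMap.comp_apply, Submodule.mkQ_apply,
    Submodule.Quotient.mk_eq_zero]
  exact hmf

end Growth

/-! ### Flat steps and their module models -/

/-- Submodules `P ≤ Q` of an algebra together with a complement `U` of `P` in `Q` such that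
multiplication by `m` maps `U` isomorphically onto a complement of `Q` in `Q + m Q`, and linear
projections onto the three summands of `P ⊕ U ⊕ m U`. -/
structure FlatSplitting {A : Type*} [CommRing A] [Algebra ℂ A] (U : Type*) [AddCommGroup U]
    [Module ℂ U] (W P Q : Submodule ℂ A) (m : A) where
  incl : U →ₗ[ℂ] A
  projP : A →ₗ[ℂ] P
  projU : A →ₗ[ℂ] U
  projMulU : A →ₗ[ℂ] U
  projP_of_mem : ∀ f : P, projP f = f
  projU_of_mem : ∀ f : P, projU f = 0
  projMulU_of_mem : ∀ f : P, projMulU f = 0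
  projP_incl : ∀ u : U, projP (incl u) = 0
  projU_incl : ∀ u : U, projU (incl u) = u
  projMulU_incl : ∀ u : U, projMulU (incl u) = 0
  projP_mul_incl : ∀ u : U, projP (m * incl u) = 0
  projU_mul_incl : ∀ u : U, projU (m * incl u) = 0
  projMulU_mul_incl : ∀ u : U, projMulU (m * incl u) = u
  one_mem_W : 1 ∈ W
  one_mem_P : 1 ∈ P
  mem_W : m ∈ W
  eq_sup : Q = P ⊔ LinearMap.range incl
  le_sup_map : Q ≤ P ⊔ P.map (LinearMap.mulLeft ℂ m)
  mul_mem : ∀ w ∈ W, ∀ f ∈ P, w * f ∈ Q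
  mul_mem_sup : ∀ w ∈ W, ∀ f ∈ Q, w * f ∈ Q ⊔ Q.map (LinearMap.mulLeft ℂ m)

namespace FlatSplitting

variable {A : Type*} [CommRing A] [Algebra ℂ A] {W P Q : Submodule ℂ A} {m : A}

open Module

lemma nonempty_of_flat [FiniteDimensional ℂ A] (h1 : (1 : A) ∈ W) {t : ℕ}
    (h : finrank ℂ ↥(W ^ (t + 1)) ≤ finrank ℂ ↥(W ^ t) + (t + 1))
    (hflat : finrank ℂ ↥(W ^ (t + 2)) + finrank ℂ ↥(W ^ t) = 2 * finrank ℂ ↥(W ^ (t + 1))) :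
    ∃ m ∈ W, Nonempty (FlatSplitting
      (Fin (finrank ℂ ↥(W ^ (t + 1)) - finrank ℂ ↥(W ^ t)) → ℂ) W (W ^ t) (W ^ (t + 1)) m) := by
  obtain ⟨m, hm, heq, hinj⟩ := exists_mul_iso_of_flat h1 h hflat
  have hle := pow_le_pow_succ_of_one_mem h1 t
  obtain ⟨U', hU'⟩ := Submodule.exists_isCompl (Submodule.comap (W ^ (t + 1)).subtype (W ^ t))
  set U := U'.map (W ^ (t + 1)).subtype with hU
  have hUle : U ≤ W ^ (t + 1) := Submodule.map_subtype_le _ _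
  have hsup : W ^ (t + 1) = W ^ t ⊔ U := by
    have := congrArg (Submodule.map (W ^ (t + 1)).subtype) hU'.sup_eq_top
    rw [Submodule.map_sup, Submodule.map_comap_subtype, inf_eq_right.2 hle,
      Submodule.map_subtype_top] at this
    exact this.symm
  have hinf : W ^ t ⊓ U = ⊥ := by
    rw [eq_bot_iff]
    rintro x ⟨hx, y, hy, rfl⟩
    have : y ∈ Submodule.comap (W ^ (t + 1)).subtype (W ^ t) ⊓ U' := ⟨hx, hy⟩
    rw [hU'.inf_eq_bot, Submodule.mem_bot] at this
    simp [this]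
  have hrank : finrank ℂ U = finrank ℂ ↥(W ^ (t + 1)) - finrank ℂ ↥(W ^ t) := by
    have := Submodule.finrank_sup_add_finrank_inf_eq (W ^ t) U
    rw [hinf, ← hsup, finrank_bot] at this
    omega
  let e : (Fin (finrank ℂ ↥(W ^ (t + 1)) - finrank ℂ ↥(W ^ t)) → ℂ) ≃ₗ[ℂ] U :=
    LinearEquiv.ofFinrankEq _ _ (by rw [hrank, finrank_fin_fun])
  let L : (↥(W ^ t) × U × U) →ₗ[ℂ] A :=
    (W ^ t).subtype.coprod (U.subtype.coprod (LinearMap.mulLeft ℂ m ∘ₗ U.subtype))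
  have hL : LinearMap.ker L = ⊥ := by
    rw [LinearMap.ker_eq_bot']
    rintro ⟨p, u, u'⟩ h0
    have h0 : (p : A) + (u + m * u') = 0 := by simpa [L] using h0
    have hu' : (u' : A) ∈ W ^ t ⊓ U := by
      refine ⟨hinj _ (hUle u'.2) ?_, u'.2⟩
      have : m * (u' : A) = -(p + u) := by linear_combination h0
      rw [this]
      exact neg_mem (add_mem (hle p.2) (hUle u.2))
    have hu'0 : u' = 0 := by
      rw [hinf, Submodule.mem_bot] at hu'
      exact Subtype.ext hu'
    subst hu'0
    have hu : (u : A) ∈ W ^ t ⊓ U := by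
      refine ⟨?_, u.2⟩
      have : (u : A) = -p := by simpa using eq_neg_of_add_eq_zero_right (by simpa using h0)
      rw [this]
      exact neg_mem p.2
    have hu0 : u = 0 := by
      rw [hinf, Submodule.mem_bot] at hu
      exact Subtype.ext hu
    subst hu0
    have hp : p = 0 := Subtype.ext (by simpa using h0)
    simp [hp]
  obtain ⟨g, hg⟩ := L.exists_leftInverse_of_injective hL
  have hgL : ∀ x, g (L x) = x := fun x => LinearMap.congr_fun hg x
  have hP : ∀ f : ↥(W ^ t), g f = (f, 0, 0) := fun f => by
    rw [← hgL (f, 0, 0)]; congr 1; simp [L]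
  have hU0 : ∀ u : U, g u = (0, u, 0) := fun u => by
    rw [← hgL (0, u, 0)]; congr 1; simp [L]
  have hU1 : ∀ u : U, g (m * u) = (0, 0, u) := fun u => by
    rw [← hgL (0, 0, u)]; congr 1; simp [L]
  exact ⟨m, hm, ⟨
    { incl := U.subtype ∘ₗ e.toLinearMap
      projP := LinearMap.fst ℂ _ _ ∘ₗ g
      projU := e.symm.toLinearMap ∘ₗ LinearMap.fst ℂ _ _ ∘ₗ LinearMap.snd ℂ _ _ ∘ₗ g
      projMulU := e.symm.toLinearMap ∘ₗ LinearMap.snd ℂ _ _ ∘ₗ LinearMap.snd ℂ _ _ ∘ₗ g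
      projP_of_mem := fun f => by simp [hP]
      projU_of_mem := fun f => by simp [hP]
      projMulU_of_mem := fun f => by simp [hP]
      projP_incl := fun f => by simp [hU0]
      projU_incl := fun f => by simp [hU0]
      projMulU_incl := fun f => by simp [hU0]
      projP_mul_incl := fun f => by simp [hU1]
      projU_mul_incl := fun f => by simp [hU1]
      projMulU_mul_incl := fun f => by simp [hU1]
      one_mem_W := h1
      one_mem_P := one_mem_pow_of_one_mem h1 t
      mem_W := hm
      eq_sup := by 
        rw [LinearMap.range_comp, LinearEquiv.range, Submodule.map_subtype_top]
        exact hsup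
      le_sup_map := heq.le
      mul_mem := fun w hw f hf => by rw [pow_succ']; exact Submodule.mul_mem_mul hw hf
      mul_mem_sup := fun w hw f hf => by
        rw [← pow_succ_succ_eq_sup h1 hm heq, pow_succ' W (t + 1)]
        exact Submodule.mul_mem_mul hw hf }⟩⟩

variable {U : Type*} [AddCommGroup U] [Module ℂ U] (s : FlatSplitting U W P Q m)

/-- The free model `P ⊕ U[z]`. -/
abbrev Model (_s : FlatSplitting U W P Q m) : Type _ := P × (ℕ →₀ U)

/-- The coordinates of an element of `P ⊕ U ⊕ m U` in the model. -/
def coord : A →ₗ[ℂ] s.Model :=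
  s.projP.prod (Finsupp.lsingle 0 ∘ₗ s.projU + Finsupp.lsingle 1 ∘ₗ s.projMulU)

/-- The action of `m` on the model. -/
def shift : End ℂ s.Model :=
  (s.coord ∘ₗ LinearMap.mulLeft ℂ m ∘ₗ P.subtype).coprod
    (LinearMap.inr ℂ _ _ ∘ₗ Finsupp.lmapDomain U ℂ Nat.succ)

/-- The action of `a` on the model. -/
def act (a : A) : End ℂ s.Model :=
  (s.coord ∘ₗ LinearMap.mulLeft ℂ a ∘ₗ P.subtype).coprod
    (Finsupp.lsum ℂ fun j => (s.shift ^ j) ∘ₗ s.coord ∘ₗ LinearMap.mulLeft ℂ a ∘ₗ s.incl)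

/-- Evaluation of the model in the algebra. -/
def realize : s.Model →ₗ[ℂ] A :=
  P.subtype.coprod (Finsupp.lsum ℂ fun j => LinearMap.mulLeft ℂ (m ^ j) ∘ₗ s.incl)

lemma incl_mem (u : U) : s.incl u ∈ Q :=
  s.eq_sup.ge (Submodule.mem_sup_right ⟨u, rfl⟩)

lemma P_le (s : FlatSplitting U W P Q m) : P ≤ Q :=
  le_sup_left.trans_eq s.eq_sup.symm

lemma coord_P (f : P) : s.coord f = (f, 0) := by
  simp [coord, s.projP_of_mem, s.projU_of_mem, s.projMulU_of_mem]

lemma coord_incl (u : U) : s.coord (s.incl u) = (0, Finsupp.single 0 u) := by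
  simp [coord, s.projP_incl, s.projU_incl, s.projMulU_incl]

lemma coord_mul_incl (u : U) : s.coord (m * s.incl u) = (0, Finsupp.single 1 u) := by
  simp [coord, s.projP_mul_incl, s.projU_mul_incl, s.projMulU_mul_incl]

lemma shift_P (f : P) : s.shift (f, 0) = s.coord (m * f) := by
  simp [shift]

lemma shift_single (j : ℕ) (u : U) :
    s.shift (0, Finsupp.single j u) = (0, Finsupp.single (j + 1) u) := by
  simp [shift]

lemma shift_pow_single (j : ℕ) (u : U) :
    (s.shift ^ j) (0, Finsupp.single 0 u) = (0, Finsupp.single j u) := by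
  induction j with
  | zero => simp
  | succ j ih => rw [pow_succ', Module.End.mul_apply, ih, shift_single]

lemma act_P (a : A) (f : P) : s.act a (f, 0) = s.coord (a * f) := by
  simp [act]

lemma act_single (a : A) (j : ℕ) (u : U) :
    s.act a (0, Finsupp.single j u) = (s.shift ^ j) (s.coord (a * s.incl u)) := by
  simp [act]

lemma realize_P (f : P) : s.realize (f, 0) = f := by
  simp [realize]

lemma realize_single (j : ℕ) (u : U) :
    s.realize (0, Finsupp.single j u) = m ^ j * s.incl u := by
  simp [realize]

lemma hom_ext {N : Type*} [AddCommGroup N] [Module ℂ N] {f g : s.Model →ₗ[ℂ] N}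
    (hP : ∀ p : P, f (p, 0) = g (p, 0))
    (hU : ∀ (j : ℕ) (u : U), f (0, Finsupp.single j u) = g (0, Finsupp.single j u)) :
    f = g := by
  apply LinearMap.prod_ext
  · ext p; exact hP p
  · ext j u; exact hU j u

lemma exists_add_of_mem {f : A} (hf : f ∈ Q) : ∃ (p : P) (u : U), f = p + s.incl u := by
  rw [s.eq_sup] at hf
  obtain ⟨p, hp, _, ⟨u, rfl⟩, rfl⟩ := Submodule.mem_sup.1 hf
  exact ⟨⟨p, hp⟩, u, rfl⟩

lemma coord_mul {f : A} (hf : f ∈ Q) : s.coord (m * f) = s.shift (s.coord f) := by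
  obtain ⟨p, u, rfl⟩ := s.exists_add_of_mem hf
  simp only [mul_add, map_add, coord_P, coord_incl, shift_P, shift_single, coord_mul_incl]

lemma act_coord (a : A) {f : A} (hf : f ∈ Q) : s.act a (s.coord f) = s.coord (a * f) := by
  obtain ⟨p, u, rfl⟩ := s.exists_add_of_mem hf
  simp only [mul_add, map_add, coord_P, coord_incl, act_P, act_single, pow_zero,
    Module.End.one_apply]

lemma act_mul_shift {a : A} (ha : a ∈ W) : s.act a * s.shift = s.shift * s.act a := by
  refine s.hom_ext (N := s.Model) (fun p => ?_) fun j u => ?_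
  · rw [Module.End.mul_apply, Module.End.mul_apply, shift_P, act_P,
      s.act_coord a (s.mul_mem m s.mem_W p p.2), ← s.coord_mul (s.mul_mem a ha p p.2)]
    congr 1
    ring
  · rw [Module.End.mul_apply, Module.End.mul_apply, shift_single, act_single, act_single,
      pow_succ', Module.End.mul_apply]

lemma end_ext {f g : End ℂ s.Model} (hf : f * s.shift = s.shift * f)
    (hg : g * s.shift = s.shift * g) (h : ∀ p : P, f (p, 0) = g (p, 0)) : f = g := by
  have key : ∀ (e : End ℂ s.Model), e * s.shift = s.shift * e → ∀ j x,
      e ((s.shift ^ j) x) = (s.shift ^ j) (e x) := fun e he j x => by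
    rw [← Module.End.mul_apply, ← Module.End.mul_apply]
    exact LinearMap.congr_fun (Commute.pow_right (show Commute e s.shift from he) j) x
  refine s.hom_ext (N := s.Model) h fun j u => ?_
  rw [← shift_pow_single, key f hf, key g hg, ← coord_incl]
  congr 1
  obtain ⟨p, hp, _, ⟨p', hp', rfl⟩, heq⟩ := Submodule.mem_sup.1 (s.le_sup_map (s.incl_mem u))
  have hcoord : s.coord (s.incl u) = s.coord p + s.shift (s.coord p') := by
    rw [← heq, map_add, LinearMap.mulLeft_apply, s.coord_mul (s.P_le hp')]
  rw [hcoord, map_add, map_add, ← pow_one s.shift, key f hf, key g hg,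
    s.coord_P ⟨p, hp⟩, s.coord_P ⟨p', hp'⟩, h, h]

lemma act_mul_comm {a b : A} (ha : a ∈ W) (hb : b ∈ W) :
    s.act a * s.act b = s.act b * s.act a := by
  refine s.end_ext ?_ ?_ fun p => ?_
  · rw [mul_assoc, s.act_mul_shift hb, ← mul_assoc, s.act_mul_shift ha, mul_assoc]
  · rw [mul_assoc, s.act_mul_shift ha, ← mul_assoc, s.act_mul_shift hb, mul_assoc]
  · rw [Module.End.mul_apply, Module.End.mul_apply, act_P, act_P,
      s.act_coord a (s.mul_mem b hb p p.2), s.act_coord b (s.mul_mem a ha p p.2)]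
    congr 1
    ring

lemma act_one : s.act 1 = 1 := by
  refine s.end_ext (s.act_mul_shift s.one_mem_W) (by simp) fun p => ?_
  rw [act_P, one_mul, coord_P, Module.End.one_apply]

lemma act_self : s.act m = s.shift := by
  refine s.end_ext (s.act_mul_shift s.mem_W) rfl fun p => ?_
  rw [act_P, shift_P]

lemma act_add (a b : A) : s.act (a + b) = s.act a + s.act b := by
  refine s.hom_ext (N := s.Model) (fun p => ?_) fun j u => ?_
  · simp [act_P, add_mul]
  · simp [act_single, add_mul]

lemma act_smul (c : ℂ) (a : A) : s.act (c • a) = c • s.act a := by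
  refine s.hom_ext (N := s.Model) (fun p => ?_) fun j u => ?_
  · simp [act_P]
  · simp [act_single]

/-- The action as a linear map. -/
def actLinear : A →ₗ[ℂ] End ℂ s.Model where
  toFun := s.act
  map_add' := s.act_add
  map_smul' := s.act_smul

lemma realize_coord_of_mem {f : A} (hf : f ∈ Q) : s.realize (s.coord f) = f := by
  obtain ⟨p, u, rfl⟩ := s.exists_add_of_mem hf
  simp only [map_add, coord_P, coord_incl, realize_P, realize_single, pow_zero, one_mul]

lemma realize_shift (x : s.Model) : s.realize (s.shift x) = m * s.realize x := by
  suffices s.realize ∘ₗ s.shift = LinearMap.mulLeft ℂ m ∘ₗ s.realize from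
    LinearMap.congr_fun this x
  refine s.hom_ext (fun p => ?_) fun j u => ?_
  · simp only [LinearMap.comp_apply, shift_P, realize_P, LinearMap.mulLeft_apply]
    exact s.realize_coord_of_mem (s.mul_mem m s.mem_W p p.2)
  · simp only [LinearMap.comp_apply, shift_single, realize_single, LinearMap.mulLeft_apply]
    ring

lemma realize_shift_pow (j : ℕ) (x : s.Model) :
    s.realize ((s.shift ^ j) x) = m ^ j * s.realize x := by
  induction j with
  | zero => simp
  | succ j ih => rw [pow_succ', Module.End.mul_apply, realize_shift, ih, pow_succ']; ring

lemma realize_coord_mul {w f : A} (hw : w ∈ W) (hf : f ∈ Q) :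
    s.realize (s.coord (w * f)) = w * f := by
  obtain ⟨x, hx, _, ⟨y, hy, rfl⟩, heq⟩ := Submodule.mem_sup.1 (s.mul_mem_sup w hw f hf)
  rw [← heq, LinearMap.mulLeft_apply, map_add, map_add, s.realize_coord_of_mem hx,
    s.coord_mul hy, realize_shift, s.realize_coord_of_mem hy]

lemma realize_act {a : A} (ha : a ∈ W) (x : s.Model) :
    s.realize (s.act a x) = a * s.realize x := by
  suffices s.realize ∘ₗ s.act a = LinearMap.mulLeft ℂ a ∘ₗ s.realize from
    LinearMap.congr_fun this x
  refine s.hom_ext (fun p => ?_) fun j u => ?_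
  · simp only [LinearMap.comp_apply, act_P, realize_P, LinearMap.mulLeft_apply]
    exact s.realize_coord_mul ha (s.P_le p.2)
  · simp only [LinearMap.comp_apply, act_single, realize_single, LinearMap.mulLeft_apply,
      realize_shift_pow, s.realize_coord_mul ha (s.incl_mem u)]
    ring

end FlatSplitting

/-! ### The ideal attached to a flat step -/

namespace FlatSplitting

variable {A : Type*} [CommRing A] [Algebra ℂ A] {W P Q : Submodule ℂ A} {m : A}

open Module

variable {U : Type*} [AddCommGroup U] [Module ℂ U] (s : FlatSplitting U W P Q m)
  {σ : Type*} (ev : MvPolynomial σ ℂ →ₐ[ℂ] A)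
  (hev : ∀ i, ev (X i) ∈ W)

open scoped IsMulCommutative in
lemma exists_algHom_end (hev : ∀ i, ev (X i) ∈ W) :
    ∃ θ : MvPolynomial σ ℂ →ₐ[ℂ] End ℂ s.Model, ∀ i, θ (X i) = s.act (ev (X i)) := by
  have hcomm : ∀ a ∈ s.act '' W, ∀ b ∈ s.act '' W, a * b = b * a := by
    rintro _ ⟨a, ha, rfl⟩ _ ⟨b, hb, rfl⟩
    exact s.act_mul_comm ha hb
  have : IsMulCommutative (Algebra.adjoin ℂ (s.act '' W)) :=
    Algebra.isMulCommutative_adjoin ℂ hcomm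
  let f : MvPolynomial σ ℂ →ₐ[ℂ] Algebra.adjoin ℂ (s.act '' W) :=
    aeval fun i => ⟨s.act (ev (X i)), Algebra.subset_adjoin ⟨_, hev i, rfl⟩⟩
  refine ⟨(Algebra.adjoin ℂ (s.act '' W)).val.comp f, fun i => ?_⟩
  simp [f]

/-- The action of polynomials on the model. -/
def polyAct : MvPolynomial σ ℂ →ₐ[ℂ] End ℂ s.Model := (s.exists_algHom_end ev hev).choose

lemma polyAct_X (i : σ) : s.polyAct ev hev (X i) = s.act (ev (X i)) :=
  (s.exists_algHom_end ev hev).choose_spec i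

lemma polyAct_of_mem {g : MvPolynomial σ ℂ} (hg : g ∈ homogeneousSubmodule σ ℂ 1) :
    s.polyAct ev hev g = s.act (ev g) := by
  rw [homogeneousSubmodule_one_eq_span_X] at hg
  have : Set.EqOn (s.polyAct ev hev).toLinearMap (s.actLinear ∘ₗ ev.toLinearMap)
      (Set.range X) := by
    rintro _ ⟨i, rfl⟩
    exact s.polyAct_X ev hev i
  exact LinearMap.eqOn_span this hg

/-- The image of `1` under a polynomial. -/
def normalForm : MvPolynomial σ ℂ →ₗ[ℂ] s.Model :=
  LinearMap.applyₗ (s.coord 1) ∘ₗ (s.polyAct ev hev).toLinearMap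

lemma normalForm_mul (F G : MvPolynomial σ ℂ) :
    s.normalForm ev hev (F * G) = s.polyAct ev hev F (s.normalForm ev hev G) := by
  simp [normalForm]

lemma realize_polyAct (F : MvPolynomial σ ℂ) (x : s.Model) :
    s.realize (s.polyAct ev hev F x) = ev F * s.realize x := by
  induction F using MvPolynomial.induction_on generalizing x with
  | C c =>
    rw [← MvPolynomial.algebraMap_eq, AlgHom.commutes, AlgHom.commutes]
    simp [Algebra.smul_def]
  | add F G hF hG => simp only [map_add, LinearMap.add_apply, hF, hG, add_mul]
  | mul_X F i hF =>
    rw [map_mul, Module.End.mul_apply, hF, polyAct_X, s.realize_act (hev i), map_mul, mul_assoc]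

lemma realize_normalForm (F : MvPolynomial σ ℂ) : s.realize (s.normalForm ev hev F) = ev F := by
  rw [← mul_one F, normalForm_mul, realize_polyAct, normalForm]
  simp [s.realize_coord_of_mem (s.P_le s.one_mem_P)]

/-- The polynomials all of whose multiples act on `1` without leaving `P`. -/
def curveIdeal : Ideal (MvPolynomial σ ℂ) where
  carrier := {F | ∀ G, (s.normalForm ev hev (G * F)).2 = 0}
  add_mem' := fun {F G} hF hG H => by rw [mul_add, map_add, Prod.snd_add, hF, hG, add_zero]
  zero_mem' := fun G => by simp
  smul_mem' := fun G F hF H => by rw [smul_eq_mul, ← mul_assoc]; exact hF _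

lemma mem_curveIdeal_of_normalForm {F : MvPolynomial σ ℂ} (h : s.normalForm ev hev F = 0) :
    F ∈ s.curveIdeal ev hev := fun G => by
  rw [normalForm_mul, h, map_zero, Prod.snd_zero]

lemma ev_mem_of_mem_curveIdeal {F : MvPolynomial σ ℂ} (h : F ∈ s.curveIdeal ev hev) :
    ev F ∈ P := by
  have h1 := h 1
  rw [one_mul] at h1
  rw [← s.realize_normalForm ev hev, ← Prod.mk.eta (p := s.normalForm ev hev F), h1, realize_P]
  exact Subtype.prop _

lemma sub_one_mem_curveIdeal {l : MvPolynomial σ ℂ} (hl : l ∈ homogeneousSubmodule σ ℂ 1)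
    (h1 : ev l = 1) : l - 1 ∈ s.curveIdeal ev hev := by
  apply mem_curveIdeal_of_normalForm
  rw [← mul_one (l - 1), normalForm_mul, map_sub, s.polyAct_of_mem ev hev hl, h1, act_one,
    map_one, sub_self, LinearMap.zero_apply]

/-- The degree filtration on the model. -/
def level (u : ℕ) : Submodule ℂ s.Model where
  carrier := {x | ∀ j, u ≤ j → x.2 j = 0}
  add_mem' := fun hx hy j hj => by simp [hx j hj, hy j hj]
  zero_mem' := fun j _ => by simp
  smul_mem' := fun c x hx j hj => by simp [hx j hj]

lemma level_mono {u v : ℕ} (h : u ≤ v) : s.level u ≤ s.level v :=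
  fun _ hx j hj => hx j (h.trans hj)

lemma coord_mem_level_one {f : A} (hf : f ∈ Q) : s.coord f ∈ s.level 1 := by
  obtain ⟨p, u, rfl⟩ := s.exists_add_of_mem hf
  rw [map_add, coord_P, coord_incl]
  intro j hj
  simp [show ¬ 0 = j by omega]

lemma coord_mem_level_two (f : A) : s.coord f ∈ s.level 2 := by
  intro j hj
  simp [coord, show ¬ 0 = j by omega, show ¬ 1 = j by omega]

lemma shift_snd_succ (x : s.Model) (j : ℕ) : (s.shift x).2 (j + 1) = x.2 j := by
  suffices Finsupp.lapply (j + 1) ∘ₗ LinearMap.snd ℂ _ _ ∘ₗ s.shift =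
      Finsupp.lapply j ∘ₗ LinearMap.snd ℂ _ _ from LinearMap.congr_fun this x
  refine s.hom_ext (fun p => ?_) fun i u => ?_
  · simp only [LinearMap.comp_apply, shift_P]
    exact s.coord_mem_level_one (s.mul_mem m s.mem_W p p.2) (j + 1) (by omega)
  · simp only [LinearMap.comp_apply, shift_single]
    simp [Finsupp.single_apply]

lemma shift_mem_level {u : ℕ} {x : s.Model} (hx : x ∈ s.level u) :
    s.shift x ∈ s.level (u + 1) := by
  intro j hj
  obtain ⟨j, rfl⟩ := Nat.exists_eq_succ_of_ne_zero (show j ≠ 0 by omega)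
  rw [Nat.succ_eq_add_one, shift_snd_succ]
  exact hx j (by omega)

lemma shift_pow_mem_level {u : ℕ} {x : s.Model} (hx : x ∈ s.level u) (i : ℕ) :
    (s.shift ^ i) x ∈ s.level (u + i) := by
  induction i with
  | zero => simpa using hx
  | succ i ih => rw [pow_succ', Module.End.mul_apply]; exact s.shift_mem_level ih

lemma act_mem_level {a : A} (ha : a ∈ W) {u : ℕ} {x : s.Model} (hx : x ∈ s.level u) :
    s.act a x ∈ s.level (u + 1) := by
  obtain ⟨p, q⟩ := x
  have hx' : ∀ j, u ≤ j → q j = 0 := hx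
  have hsum : ((p, q) : s.Model) = (p, 0) + ∑ j ∈ q.support, (0, Finsupp.single j (q j)) := by
    have : (∑ j ∈ q.support, ((0, Finsupp.single j (q j)) : s.Model)) = (0, q) := by
      change ∑ j ∈ q.support, LinearMap.inr ℂ P (ℕ →₀ U) (Finsupp.single j (q j)) = _
      rw [← map_sum]
      exact congrArg _ q.sum_single
    simp [this]
  rw [hsum, map_add, act_P, map_sum]
  refine add_mem (s.level_mono (by omega) (s.coord_mem_level_one (s.mul_mem a ha p p.2)))
    (sum_mem fun j hj => ?_)
  have hju : j < u := by
    by_contra h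
    exact Finsupp.mem_support_iff.1 hj (hx' j (by omega))
  rw [act_single]
  exact s.level_mono (by omega) (s.shift_pow_mem_level (s.coord_mem_level_two _) j)

lemma normalForm_mem_level {u : ℕ} {F : MvPolynomial σ ℂ} (hF : F ∈ homogeneousSubmodule σ ℂ u) :
    s.normalForm ev hev F ∈ s.level u := by
  suffices homogeneousSubmodule σ ℂ u ≤ (s.level u).comap (s.normalForm ev hev) from this hF
  clear hF F
  induction u with
  | zero =>
    intro F hF j _
    obtain ⟨c, rfl⟩ : ∃ c, F = C c := ⟨_, totalDegree_eq_zero_iff_eq_C.1 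
      (Nat.le_zero.1 (IsHomogeneous.totalDegree_le hF))⟩
    rw [← MvPolynomial.algebraMap_eq, Algebra.algebraMap_eq_smul_one, map_smul]
    simp [normalForm, s.coord_P ⟨1, s.one_mem_P⟩]
  | succ u ih =>
    rw [← homogeneousSubmodule_one_pow, pow_succ', homogeneousSubmodule_one_pow, Submodule.mul_le]
    intro g hg F hF
    rw [Submodule.mem_comap, normalForm_mul, s.polyAct_of_mem ev hev hg]
    refine s.act_mem_level ?_ (ih hF)
    have : homogeneousSubmodule σ ℂ 1 ≤ W.comap ev.toLinearMap := by
      rw [homogeneousSubmodule_one_eq_span_X, Submodule.span_le]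
      rintro _ ⟨i, rfl⟩
      exact hev i
    exact this hg

lemma finrank_level_le [FiniteDimensional ℂ A] [FiniteDimensional ℂ U] (u : ℕ) :
    FiniteDimensional ℂ (s.level u) ∧ finrank ℂ (s.level u) ≤ finrank ℂ P + finrank ℂ U * u := by
  let f : s.level u →ₗ[ℂ] P × (Fin u → U) :=
    ((LinearMap.fst ℂ _ _).prod (LinearMap.pi fun i : Fin u =>
      Finsupp.lapply (i : ℕ) ∘ₗ LinearMap.snd ℂ _ _)) ∘ₗ (s.level u).subtype
  have hf : Function.Injective f := by
    rintro ⟨⟨p, q⟩, hx⟩ ⟨⟨p', q'⟩, hx'⟩ h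
    have h1 : p = p' := congrArg Prod.fst h
    have h2 : ∀ i : Fin u, q i = q' i := fun i => congrFun (congrArg Prod.snd h) i
    have h3 : q = q' := by
      ext1 j
      by_cases hj : j < u
      · exact h2 ⟨j, hj⟩
      · exact (hx j (by omega)).trans (hx' j (by omega)).symm
    simp [h1, h3]
  refine ⟨FiniteDimensional.of_injective f hf, ?_⟩
  refine (LinearMap.finrank_le_finrank_of_injective hf).trans ?_
  simp [Module.finrank_pi_fintype, mul_comm]

lemma mem_curveIdeal_of_sub_C_mul {M : MvPolynomial σ ℂ} (hM : M ∈ homogeneousSubmodule σ ℂ 1)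
    (hm : ev M = m) (c : ℂ) {F : MvPolynomial σ ℂ}
    (h : (M - C c) * F ∈ s.curveIdeal ev hev) : F ∈ s.curveIdeal ev hev := by
  intro G
  have h := h G
  rw [mul_left_comm, normalForm_mul, map_sub, s.polyAct_of_mem ev hev hM, hm, act_self,
    ← MvPolynomial.algebraMap_eq, AlgHom.commutes, Algebra.algebraMap_eq_smul_one] at h
  set x := s.normalForm ev hev (G * F)
  have hstep : ∀ j, x.2 j = c • x.2 (j + 1) := fun j => by
    have := DFunLike.congr_fun h (j + 1)
    rw [← shift_snd_succ]
    simpa [sub_eq_zero] using this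
  have hiter : ∀ i j, x.2 j = c ^ i • x.2 (j + i) := fun i => by
    induction i with
    | zero => simp
    | succ i ih => intro j; rw [ih, hstep, smul_smul, pow_succ, add_assoc]
  ext1 j
  obtain ⟨N, hN⟩ := x.2.support.exists_nat_subset_range
  rw [hiter N j, show x.2 (j + N) = 0 from ?_, smul_zero, Finsupp.zero_apply]
  by_contra hne
  have := Finset.mem_range.1 (hN (Finsupp.mem_support_iff.2 hne))
  omega

end FlatSplitting

open Module in
/-- Flat growth of the images of the forms of degree `t` under `ev` produces an ideal of linear
growth whose elements evaluate into the image of the forms of degree `t`. -/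
theorem exists_ideal_of_flat {σ A : Type*} [Finite σ] [CommRing A] [Algebra ℂ A]
    [FiniteDimensional ℂ A] (ev : MvPolynomial σ ℂ →ₐ[ℂ] A) {l : MvPolynomial σ ℂ}
    (hl : l ∈ homogeneousSubmodule σ ℂ 1) (hl1 : ev l = 1) {W : Submodule ℂ A}
    (hW : W = (homogeneousSubmodule σ ℂ 1).map ev.toLinearMap) {t : ℕ}
    (h : finrank ℂ ↥(W ^ (t + 1)) ≤ finrank ℂ ↥(W ^ t) + (t + 1))
    (hflat : finrank ℂ ↥(W ^ (t + 2)) + finrank ℂ ↥(W ^ t) = 2 * finrank ℂ ↥(W ^ (t + 1))) :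
    ∃ I : Ideal (MvPolynomial σ ℂ), ∃ M ∈ homogeneousSubmodule σ ℂ 1, ∃ c : ℕ,
      l - 1 ∈ I ∧ (∀ F ∈ I, ev F ∈ W ^ t) ∧ (∀ (a : ℂ) (F), (M - C a) * F ∈ I → F ∈ I) ∧
      ∀ u, finrank ℂ ((homogeneousSubmodule σ ℂ u).map (I.restrictScalars ℂ).mkQ) ≤
        (finrank ℂ ↥(W ^ (t + 1)) - finrank ℂ ↥(W ^ t)) * u + c := by
  have h1 : (1 : A) ∈ W := by rw [hW]; exact ⟨l, hl, hl1⟩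
  obtain ⟨m, hm, ⟨s⟩⟩ := FlatSplitting.nonempty_of_flat h1 h hflat
  have hev : ∀ i, ev (X i) ∈ W := fun i => by
    rw [hW]; exact ⟨X i, isHomogeneous_X ℂ i, rfl⟩
  obtain ⟨M, hM, hMm⟩ : ∃ M ∈ homogeneousSubmodule σ ℂ 1, ev M = m := by rwa [hW] at hm
  refine ⟨s.curveIdeal ev hev, M, hM, finrank ℂ ↥(W ^ t), s.sub_one_mem_curveIdeal ev hev hl hl1,
    fun F hF => s.ev_mem_of_mem_curveIdeal ev hev hF,
    fun a F hF => s.mem_curveIdeal_of_sub_C_mul ev hev hM hMm a hF, fun u => ?_⟩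
  have hfin : FiniteDimensional ℂ (homogeneousSubmodule σ ℂ u) :=
    Module.Finite.iff_fg.2 (homogeneousSubmodule_fg σ ℂ u)
  have e1 := finrank_map_add_finrank_inf_ker ((s.curveIdeal ev hev).restrictScalars ℂ).mkQ
    (homogeneousSubmodule σ ℂ u)
  have e2 := finrank_map_add_finrank_inf_ker (s.normalForm ev hev) (homogeneousSubmodule σ ℂ u)
  have e3 : homogeneousSubmodule σ ℂ u ⊓ LinearMap.ker (s.normalForm ev hev) ≤
      homogeneousSubmodule σ ℂ u ⊓
        LinearMap.ker ((s.curveIdeal ev hev).restrictScalars ℂ).mkQ := by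
    refine inf_le_inf_left _ fun F hF => ?_
    rw [Submodule.ker_mkQ]
    exact s.mem_curveIdeal_of_normalForm ev hev hF
  have e3 := Submodule.finrank_mono e3
  obtain ⟨hf, e4⟩ := s.finrank_level_le u
  have e5 : (homogeneousSubmodule σ ℂ u).map (s.normalForm ev hev) ≤ s.level u := by
    rintro _ ⟨F, hF, rfl⟩
    exact s.normalForm_mem_level ev hev hF
  have e5 := Submodule.finrank_mono e5
  rw [finrank_fin_fun] at e4
  omega

/-! ### A numerical lemma -/

lemma mul_sub_le_sum_min (μ : ℕ) {κ : ℕ} (hκ : κ ≤ μ) :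
    κ * (2 * μ - κ) ≤ ∑ u ∈ Finset.range (2 * μ - 1), min κ (min (u + 1) (2 * μ - 1 - u)) := by
  induction κ with
  | zero => simp
  | succ κ ih =>
    have h1 := ih (by omega)
    have h2 : ∑ u ∈ Finset.range (2 * μ - 1), (min κ (min (u + 1) (2 * μ - 1 - u)) +
        if u ∈ Finset.Ico κ (2 * μ - 1 - κ) then 1 else 0) ≤
        ∑ u ∈ Finset.range (2 * μ - 1), min (κ + 1) (min (u + 1) (2 * μ - 1 - u)) := by
      refine Finset.sum_le_sum fun u hu => ?_
      split_ifs with h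
      · rw [Finset.mem_Ico] at h
        omega
      · omega
    rw [Finset.sum_add_distrib, Finset.sum_ite_mem, Finset.inter_eq_right.2 (fun u hu => by
      rw [Finset.mem_Ico] at hu
      exact Finset.mem_range.2 (by omega))] at h2
    simp only [Finset.sum_const, Nat.card_Ico, smul_eq_mul, mul_one] at h2
    refine le_trans ?_ h2
    refine le_trans ?_ (Nat.add_le_add_right h1 _)
    obtain ⟨e, rfl⟩ := Nat.exists_eq_add_of_le hκ
    rw [show 2 * (κ + 1 + e) - (κ + 1) = κ + 1 + 2 * e by omega,
      show 2 * (κ + 1 + e) - κ = κ + 2 + 2 * e by omega,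
      show 2 * (κ + 1 + e) - 1 - κ - κ = 1 + 2 * e by omega]
    nlinarith

lemma le_sum_add_one_of_min_le {g : ℕ → ℕ} {μ κ : ℕ} (hμ : 1 ≤ μ) (hκ : κ ≤ μ)
    (h : ∀ u < 2 * μ - 2, min κ (min (u + 2) (2 * μ - 2 - u)) ≤ g u) :
    κ * (2 * μ - κ) ≤ ∑ u ∈ Finset.range (2 * μ - 2), g u + 1 := by
  refine (mul_sub_le_sum_min μ hκ).trans ?_
  rw [show 2 * μ - 1 = 2 * μ - 2 + 1 by omega, Finset.sum_range_succ']
  refine Nat.add_le_add (Finset.sum_le_sum fun u hu => (le_of_eq ?_).trans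
    (h u (Finset.mem_range.1 hu))) (by omega)
  congr 2
  omega

/-- A numerical function whose small values decrease is constant somewhere, and its sum is large
compared with the last such value. -/
lemma exists_flat_step {g : ℕ → ℕ} {μ : ℕ} (hμ : 2 ≤ μ) (hconc : ∀ u, g u ≤ u + 1 → g (u + 1) ≤ g u)
    (hpos : 1 ≤ g (2 * μ - 3)) (hsum : ∑ u ∈ Finset.range (2 * μ - 2), g u + 1 ≤ μ ^ 2 - 1) :
    ∃ t, t + 1 ≤ 2 * μ - 3 ∧ g t ≤ t + 1 ∧ g (t + 1) = g t ∧ 1 ≤ g t ∧ g t ≤ μ - 1 ∧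
      μ * g t < ∑ u ∈ Finset.range (2 * μ - 2), g u + 1 := by
  have hanti : ∀ u, g u ≤ u + 1 → ∀ i, g (u + i) ≤ g u := fun u hu i => by
    induction i with
    | zero => simp
    | succ i ih => exact (hconc (u + i) (by omega)).trans ih
  have hμ2 : 1 ≤ μ ^ 2 := Nat.one_le_pow _ _ (by omega)
  have hstrict : ∀ u, u ≤ 2 * μ - 3 → g u ≤ u + 1 →
      (∀ v, u ≤ v → v < 2 * μ - 3 → g v ≤ v + 1 → g (v + 1) ≠ g v) → 2 * μ - 2 - u ≤ g u := by
    intro u hu hgu hne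
    have key : ∀ i, i + u ≤ 2 * μ - 3 → g (u + i) + i ≤ g u := fun i => by
      induction i with
      | zero => simp
      | succ i ih =>
        intro hi
        have h1 := ih (by omega)
        have h2 := hconc (u + i) (by omega)
        have h3 := hne (u + i) (by omega) (by omega) (by omega)
        change g (u + i + 1) + _ ≤ _
        omega
    have := key (2 * μ - 3 - u) (by omega)
    rw [show u + (2 * μ - 3 - u) = 2 * μ - 3 by omega] at this
    omega
  by_cases hex : ∃ t, t < 2 * μ - 3 ∧ g t ≤ t + 1 ∧ g (t + 1) = g t
  · obtain ⟨t, ⟨ht, hgt, heq⟩, hmax⟩ : ∃ t, (t < 2 * μ - 3 ∧ g t ≤ t + 1 ∧ g (t + 1) = g t) ∧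
        ∀ v, t < v → ¬ (v < 2 * μ - 3 ∧ g v ≤ v + 1 ∧ g (v + 1) = g v) := by
      classical
      obtain ⟨t₀, ht₀⟩ := hex
      have hs := Nat.findGreatest_spec (P := fun t => t < 2 * μ - 3 ∧ g t ≤ t + 1 ∧ g (t + 1) = g t)
        ht₀.1.le ht₀
      refine ⟨_, hs, fun v hv h => Nat.findGreatest_is_greatest hv h.1.le h⟩
    have hk1 : 1 ≤ g t := by
      have := hanti t hgt (2 * μ - 3 - t)
      rw [show t + (2 * μ - 3 - t) = 2 * μ - 3 by omega] at this
      omega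
    have hbound : ∀ u < 2 * μ - 2, min (g t) (min (u + 2) (2 * μ - 2 - u)) ≤ g u := by
      intro u hu
      by_cases hgu : g u ≤ u + 1
      · by_cases hut : u ≤ t
        · have := hanti u hgu (t - u)
          rw [show u + (t - u) = t by omega] at this
          omega
        · have := hstrict u (by omega) hgu fun v hv hv1 hv2 hv3 => hmax v (by omega) ⟨hv1, hv2, hv3⟩
          omega
      · omega
    have hlt : g t < μ := by
      by_contra hge
      have := le_sum_add_one_of_min_le (g := g) (κ := μ) (by omega) le_rfl
        fun u hu => (by have := hbound u hu; omega)
      rw [show 2 * μ - μ = μ by omega, ← sq] at this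
      omega
    refine ⟨t, ht, hgt, heq, hk1, by omega, ?_⟩
    refine lt_of_lt_of_le ?_ (le_sum_add_one_of_min_le (by omega) hlt.le hbound)
    rw [mul_comm]
    exact Nat.mul_lt_mul_of_pos_left (by omega) (by omega)
  · exfalso
    have hbound : ∀ u < 2 * μ - 2, min μ (min (u + 2) (2 * μ - 2 - u)) ≤ g u := by
      intro u hu
      by_cases hgu : g u ≤ u + 1
      · have := hstrict u (by omega) hgu fun v _ hv1 hv2 hv3 => hex ⟨v, hv1, hv2, hv3⟩
        omega
      · omega
    have := le_sum_add_one_of_min_le (by omega) le_rfl hbound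
    rw [show 2 * μ - μ = μ by omega, ← sq] at this
    omega

/-! ### Vanishing of forms at points of projective space -/

theorem eval_smul_of_isHomogeneous {σ : Type*} {F : MvPolynomial σ ℂ} {d : ℕ}
    (hF : F.IsHomogeneous d) (c : ℂ) (v : σ → ℂ) : eval (c • v) F = c ^ d * eval v F := by
  rw [eval_eq, eval_eq, Finset.mul_sum]
  refine Finset.sum_congr rfl fun m hm => ?_
  have hm : ∑ i ∈ m.support, m i = d := by
    simpa [Finsupp.weight_apply, Finsupp.sum] using hF (mem_support_iff.1 hm)
  simp only [Pi.smul_apply, smul_eq_mul, mul_pow, Finset.prod_mul_distrib,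
    Finset.prod_pow_eq_pow_sum, hm]
  ring

theorem vanishesAt_iff {n d : ℕ} {F : MvPolynomial (Fin (n + 1)) ℂ} (hF : F.IsHomogeneous d)
    (p : Pt n) : VanishesAt F p ↔ eval p.rep F = 0 := by
  refine ⟨fun h => h p.rep p.rep_nonzero p.mk_rep.symm, fun h v hv hp => ?_⟩
  rw [← p.mk_rep, Projectivization.mk_eq_mk_iff'] at hp
  obtain ⟨a, ha⟩ := hp
  rw [← ha, eval_smul_of_isHomogeneous hF] at h
  refine (mul_eq_zero.1 h).resolve_left (pow_ne_zero _ ?_)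
  rintro rfl
  exact p.rep_nonzero (by rw [← ha, zero_smul])

theorem vanishesAt_mk_iff {n d : ℕ} {F : MvPolynomial (Fin (n + 1)) ℂ} (hF : F.IsHomogeneous d)
    {v : Fin (n + 1) → ℂ} (hv : v ≠ 0) :
    VanishesAt F (Projectivization.mk ℂ v hv) ↔ eval v F = 0 := by
  refine ⟨fun h => h v hv rfl, fun h w hw hp => ?_⟩
  rw [Projectivization.mk_eq_mk_iff'] at hp
  obtain ⟨a, rfl⟩ := hp
  rw [eval_smul_of_isHomogeneous hF] at h
  refine (mul_eq_zero.1 h).resolve_left (pow_ne_zero _ ?_)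
  rintro rfl
  exact hv (zero_smul _ _)

theorem vanishesAt_mul_iff {n d e : ℕ} {F G : MvPolynomial (Fin (n + 1)) ℂ}
    (hF : F.IsHomogeneous d) (hG : G.IsHomogeneous e) (p : Pt n) :
    VanishesAt (F * G) p ↔ VanishesAt F p ∨ VanishesAt G p := by
  rw [vanishesAt_iff hF, vanishesAt_iff hG, vanishesAt_iff (hF.mul hG), map_mul, mul_eq_zero]

/-- The representative of `p` on which the linear form `l` takes the value `1`. -/
def normalizedRep {n : ℕ} (l : MvPolynomial (Fin (n + 1)) ℂ) (p : Pt n) : Fin (n + 1) → ℂ :=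
  (eval p.rep l)⁻¹ • p.rep

theorem eval_normalizedRep_eq_zero_iff {n d : ℕ} {l F : MvPolynomial (Fin (n + 1)) ℂ}
    (hl : l.IsHomogeneous 1) {p : Pt n} (hp : ¬ VanishesAt l p) (hF : F.IsHomogeneous d) :
    eval (normalizedRep l p) F = 0 ↔ VanishesAt F p := by
  rw [vanishesAt_iff hl] at hp
  rw [vanishesAt_iff hF, normalizedRep, eval_smul_of_isHomogeneous hF, mul_eq_zero,
    or_iff_right (pow_ne_zero _ (inv_ne_zero hp))]

theorem eval_normalizedRep_self {n : ℕ} {l : MvPolynomial (Fin (n + 1)) ℂ}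
    (hl : l.IsHomogeneous 1) {p : Pt n} (hp : ¬ VanishesAt l p) :
    eval (normalizedRep l p) l = 1 := by
  rw [vanishesAt_iff hl] at hp
  rw [normalizedRep, eval_smul_of_isHomogeneous hl, pow_one, inv_mul_cancel₀ hp]

theorem exists_linear_not_vanishesAt {n : ℕ} (p : Pt n) :
    ∃ l : MvPolynomial (Fin (n + 1)) ℂ, l.IsHomogeneous 1 ∧ ¬ VanishesAt l p := by
  obtain ⟨i, hi⟩ := Function.ne_iff.1 p.rep_nonzero
  exact ⟨X i, isHomogeneous_X ℂ i, by rw [vanishesAt_iff (isHomogeneous_X ℂ i)]; simpa using hi⟩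

theorem exists_linear_separating {n : ℕ} {p q : Pt n} (hpq : q ≠ p) :
    ∃ l : MvPolynomial (Fin (n + 1)) ℂ, l.IsHomogeneous 1 ∧ VanishesAt l q ∧ ¬ VanishesAt l p := by
  have hl : ∀ i j, IsHomogeneous (C (q.rep j) * X i - C (q.rep i) * X j :
      MvPolynomial (Fin (n + 1)) ℂ) 1 := fun i j => by
    simpa using (((isHomogeneous_C _ (q.rep j)).mul (isHomogeneous_X ℂ i)).sub
      ((isHomogeneous_C _ (q.rep i)).mul (isHomogeneous_X ℂ j)))
  by_contra! h
  apply hpq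
  have key : ∀ i j, q.rep j * p.rep i = q.rep i * p.rep j := fun i j => by
    have := h _ (hl i j) (by rw [vanishesAt_iff (hl i j)]; simp; ring)
    rw [vanishesAt_iff (hl i j)] at this
    simpa [sub_eq_zero] using this
  obtain ⟨i, hi⟩ := Function.ne_iff.1 p.rep_nonzero
  rw [← q.mk_rep, ← p.mk_rep, Projectivization.mk_eq_mk_iff']
  refine ⟨q.rep i / p.rep i, funext fun j => ?_⟩
  have := key i j
  simp only [Pi.smul_apply, smul_eq_mul, Pi.zero_apply] at hi ⊢
  field_simp
  linear_combination -this

theorem exists_form_separating {n : ℕ} (Z : Finset (Pt n)) (p : Pt n) {u : ℕ} (hu : Z.card ≤ u) :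
    ∃ F : MvPolynomial (Fin (n + 1)) ℂ, F.IsHomogeneous u ∧
      (∀ q ∈ Z, q ≠ p → VanishesAt F q) ∧ ¬ VanishesAt F p := by
  classical
  induction Z using Finset.induction_on generalizing u with
  | empty =>
    obtain ⟨l, hl, hlp⟩ := exists_linear_not_vanishesAt p
    have hl' : (l ^ u).IsHomogeneous u := by simpa using hl.pow u
    refine ⟨l ^ u, hl', by simp, ?_⟩
    rw [vanishesAt_iff hl] at hlp
    rw [vanishesAt_iff hl', map_pow]
    exact pow_ne_zero _ hlp
  | insert q Z hq ih =>
    rw [Finset.card_insert_of_notMem hq] at hu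
    obtain ⟨u, rfl⟩ : ∃ w, u = w + 1 := ⟨u - 1, by omega⟩
    obtain ⟨F, hF, hFZ, hFp⟩ := ih (u := u) (by omega)
    obtain ⟨l, hl, hlq, hlp⟩ : ∃ l : MvPolynomial (Fin (n + 1)) ℂ, l.IsHomogeneous 1 ∧
        (q ≠ p → VanishesAt l q) ∧ ¬ VanishesAt l p := by
      by_cases h : q = p
      · obtain ⟨l, hl, hlp⟩ := exists_linear_not_vanishesAt p
        exact ⟨l, hl, fun h' => (h' h).elim, hlp⟩
      · obtain ⟨l, hl, hlq, hlp⟩ := exists_linear_separating h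
        exact ⟨l, hl, fun _ => hlq, hlp⟩
    refine ⟨F * l, hF.mul hl, fun r hr hrp => ?_, ?_⟩
    · rw [vanishesAt_mul_iff hF hl]
      rcases Finset.mem_insert.1 hr with rfl | hr
      · exact Or.inr (hlq hrp)
      · exact Or.inl (hFZ r hr hrp)
    · rw [vanishesAt_mul_iff hF hl]
      exact not_or.2 ⟨hFp, hlp⟩

/-! ### Curves defined by prime ideals of linear growth -/

section PrimeCurve

open Module

variable {n : ℕ}

/-- The dimension of the space of residues modulo `I` of forms of degree `u`. -/
def hilbertFn (I : Ideal (MvPolynomial (Fin (n + 1)) ℂ)) (u : ℕ) : ℕ :=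
  finrank ℂ ((homogeneousSubmodule (Fin (n + 1)) ℂ u).map (I.restrictScalars ℂ).mkQ)

/-- The projective algebraic set cut out by the forms contained in `I`. -/
def projLocus (I : Ideal (MvPolynomial (Fin (n + 1)) ℂ)) : Set (Pt n) :=
  ZeroLocus {F | (∃ d, F.IsHomogeneous d) ∧ F ∈ I}

variable {P : Ideal (MvPolynomial (Fin (n + 1)) ℂ)} {l M : MvPolynomial (Fin (n + 1)) ℂ}

instance finiteDimensional_homogeneousSubmodule (u : ℕ) :
    FiniteDimensional ℂ (homogeneousSubmodule (Fin (n + 1)) ℂ u) :=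
  Module.Finite.iff_fg.2 (homogeneousSubmodule_fg (Fin (n + 1)) ℂ u)

theorem hilbertFn_add_finrank_inf (I : Ideal (MvPolynomial (Fin (n + 1)) ℂ)) (u : ℕ) :
    hilbertFn I u + finrank ℂ ↥(homogeneousSubmodule (Fin (n + 1)) ℂ u ⊓ I.restrictScalars ℂ) =
      finrank ℂ (homogeneousSubmodule (Fin (n + 1)) ℂ u) := by
  have := finrank_map_add_finrank_inf_ker (I.restrictScalars ℂ).mkQ
    (homogeneousSubmodule (Fin (n + 1)) ℂ u)
  rwa [Submodule.ker_mkQ] at this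

theorem hilbertFn_anti {I J : Ideal (MvPolynomial (Fin (n + 1)) ℂ)} (h : I ≤ J) (u : ℕ) :
    hilbertFn J u ≤ hilbertFn I u := by
  have e1 := hilbertFn_add_finrank_inf I u
  have e2 := hilbertFn_add_finrank_inf J u
  have h' : homogeneousSubmodule (Fin (n + 1)) ℂ u ⊓ I.restrictScalars ℂ ≤
      homogeneousSubmodule (Fin (n + 1)) ℂ u ⊓ J.restrictScalars ℂ := inf_le_inf_left _ h
  have e3 := Submodule.finrank_mono h'
  omega

theorem mem_zeroLocus_singleton {F : MvPolynomial (Fin (n + 1)) ℂ} {p : Pt n} :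
    p ∈ ZeroLocus {F} ↔ VanishesAt F p :=
  ⟨fun h => h F rfl, fun h G hG => by rwa [Set.mem_singleton_iff.1 hG]⟩

theorem mk_mem_projLocus {I : Ideal (MvPolynomial (Fin (n + 1)) ℂ)} {v : Fin (n + 1) → ℂ}
    (hv : v ≠ 0) (h : v ∈ zeroLocus ℂ I) : Projectivization.mk ℂ v hv ∈ projLocus I := by
  rintro F ⟨⟨d, hd⟩, hF⟩
  rw [vanishesAt_mk_iff hd]
  exact h F hF

theorem isAlgebraicSet_projLocus (I : Ideal (MvPolynomial (Fin (n + 1)) ℂ)) :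
    IsAlgebraicSet (projLocus I) :=
  ⟨_, fun _ hF => hF.1, rfl⟩

theorem projLocus_subset_iff [P.IsPrime] (hl : l.IsHomogeneous 1) (hlP : l - 1 ∈ P) {d : ℕ}
    {F : MvPolynomial (Fin (n + 1)) ℂ} (hF : F.IsHomogeneous d) :
    projLocus P ⊆ ZeroLocus {F} ↔ F ∈ P := by
  refine ⟨fun h => ?_, fun h p hp => mem_zeroLocus_singleton.2 (hp F ⟨⟨d, hF⟩, h⟩)⟩
  rw [← MvPolynomial.IsPrime.vanishingIdeal_zeroLocus (K := ℂ) P]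
  intro v hv
  have hv0 : v ≠ 0 := by
    rintro rfl
    have h1 : eval (0 : Fin (n + 1) → ℂ) (l - 1) = 0 := hv _ hlP
    have h0 := eval_smul_of_isHomogeneous hl 0 0
    simp at h0 h1
    simp [h0] at h1
  have := mem_zeroLocus_singleton.1 (h (mk_mem_projLocus hv0 hv))
  rwa [vanishesAt_mk_iff hF] at this

theorem exists_form_of_not_projLocus_subset [P.IsPrime] (hl : l.IsHomogeneous 1)
    (hlP : l - 1 ∈ P) {A : Set (Pt n)} (hA : IsAlgebraicSet A) (h : ¬ projLocus P ⊆ A) :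
    ∃ F d, F.IsHomogeneous d ∧ F ∉ P ∧ A ⊆ ZeroLocus {F} := by
  obtain ⟨S, hS, rfl⟩ := hA
  by_contra! hc
  refine h fun p hp F hF => ?_
  obtain ⟨d, hd⟩ := hS F hF
  refine mem_zeroLocus_singleton.1 ((projLocus_subset_iff hl hlP hd).2 ?_ hp)
  by_contra hFP
  exact hc F d hd hFP fun q hq => mem_zeroLocus_singleton.2 (hq F hF)

theorem isIrreducibleAlgSet_projLocus [hP : P.IsPrime] (hl : l.IsHomogeneous 1)
    (hlP : l - 1 ∈ P) : IsIrreducibleAlgSet (projLocus P) := by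
  refine ⟨isAlgebraicSet_projLocus P, ?_, fun A B hA hB h => ?_⟩
  · by_contra! hc
    have h0 : (1 : MvPolynomial (Fin (n + 1)) ℂ) ∈ P :=
      (projLocus_subset_iff hl hlP (isHomogeneous_one _ _)).1 (by simp [hc])
    exact hP.ne_top ((Ideal.eq_top_iff_one _).2 h0)
  · by_contra! hc
    obtain ⟨F, d, hF, hFP, hFA⟩ := exists_form_of_not_projLocus_subset hl hlP hA hc.1
    obtain ⟨G, e, hG, hGP, hGB⟩ := exists_form_of_not_projLocus_subset hl hlP hB hc.2
    refine (hP.mul_notMem hFP hGP) ((projLocus_subset_iff hl hlP (hF.mul hG)).1 fun p hp => ?_)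
    rw [mem_zeroLocus_singleton, vanishesAt_mul_iff hF hG]
    exact (h hp).imp (fun h => mem_zeroLocus_singleton.1 (hFA h))
      fun h => mem_zeroLocus_singleton.1 (hGB h)

theorem infinite_projLocus [hP : P.IsPrime] (hl : l.IsHomogeneous 1) (hlP : l - 1 ∈ P)
    (hM : M.IsHomogeneous 1) (hMP : ∀ a : ℂ, M - C a ∉ P) : (projLocus P).Infinite := by
  intro hfin
  have hlin : ∀ a : ℂ, (M - C a * l).IsHomogeneous 1 := fun a =>
    hM.sub (by simpa using (isHomogeneous_C _ a).mul hl)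
  have hlM : ∀ p : Pt n, ∃ a : ℂ, VanishesAt (l * (M - C a * l)) p := fun p => by
    refine ⟨eval p.rep M / eval p.rep l, ?_⟩
    rw [vanishesAt_iff (hl.mul (hlin _))]
    by_cases h : eval p.rep l = 0
    · simp [h]
    · simp [h]
  choose a ha using hlM
  have hhom : (∏ p ∈ hfin.toFinset, l * (M - C (a p) * l)).IsHomogeneous
      (∑ _p ∈ hfin.toFinset, (1 + 1)) :=
    IsHomogeneous.prod _ _ _ fun p _ => hl.mul (hlin (a p))
  have hmem : ∏ p ∈ hfin.toFinset, l * (M - C (a p) * l) ∈ P := by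
    refine (projLocus_subset_iff hl hlP hhom).1 fun p hp => ?_
    rw [mem_zeroLocus_singleton, vanishesAt_iff hhom, map_prod]
    exact Finset.prod_eq_zero (hfin.mem_toFinset.2 hp)
      ((vanishesAt_iff (hl.mul (hlin (a p))) p).1 (ha p))
  obtain ⟨p, -, hp⟩ := hP.prod_mem_iff.1 hmem
  rcases hP.mem_or_mem hp with h | h
  · exact hP.ne_top ((Ideal.eq_top_iff_one _).2 (by simpa using P.sub_mem h hlP))
  · refine hMP (a p) ?_
    have := P.add_mem h (P.mul_mem_left (C (a p)) hlP)
    convert this using 1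
    ring

theorem hilbertFn_add_card_le [hP : P.IsPrime] {F : MvPolynomial (Fin (n + 1)) ℂ} {e : ℕ}
    (hF : F.IsHomogeneous e) (hFP : F ∉ P) {Z : Finset (Pt n)}
    (hZ : (Z : Set (Pt n)) ⊆ projLocus P ∩ ZeroLocus {F}) {u : ℕ} (hu : Z.card ≤ u) :
    hilbertFn P u + Z.card ≤ hilbertFn P (u + e) := by
  classical
  let E : MvPolynomial (Fin (n + 1)) ℂ →ₗ[ℂ] (Z → ℂ) :=
    LinearMap.pi fun z => (aeval z.1.rep).toLinearMap
  have hE : ∀ G z, E G z = eval z.1.rep G := fun G z => rfl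
  let N := homogeneousSubmodule (Fin (n + 1)) ℂ (u + e)
  have hsurj : N.map E = ⊤ := by
    rw [eq_top_iff, ← (Pi.basisFun ℂ Z).span_eq, Submodule.span_le]
    rintro _ ⟨z, rfl⟩
    obtain ⟨G, hG, hGZ, hGz⟩ := exists_form_separating Z z.1 (u := u + e) (by omega)
    rw [vanishesAt_iff hG] at hGz
    refine ⟨(eval z.1.rep G)⁻¹ • G, N.smul_mem _ hG, funext fun w => ?_⟩
    rw [hE, smul_eval, Pi.basisFun_apply]
    by_cases hwz : w = z
    · subst hwz
      simp [hGz]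
    · have := (vanishesAt_iff hG _).1 (hGZ w.1 w.2 fun h => hwz (Subtype.ext h))
      simp [this, hwz]
  let φ := (P.restrictScalars ℂ).mkQ
  have hker : LinearMap.ker φ = P.restrictScalars ℂ := Submodule.ker_mkQ _
  have h1 := finrank_map_add_finrank_inf_ker E N
  have h2 := hilbertFn_add_finrank_inf P (u + e)
  have h3 := finrank_map_add_finrank_inf_ker φ (N ⊓ LinearMap.ker E)
  have h4 : finrank ℂ ↥(N ⊓ P.restrictScalars ℂ) =
      finrank ℂ ↥(N ⊓ LinearMap.ker E ⊓ LinearMap.ker φ) := by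
    have : N ⊓ P.restrictScalars ℂ = N ⊓ LinearMap.ker E ⊓ P.restrictScalars ℂ := by
      refine le_antisymm (fun G hG => ⟨⟨hG.1, funext fun z => ?_⟩, hG.2⟩)
        (inf_le_inf_right _ inf_le_left)
      exact (vanishesAt_iff hG.1 _).1 ((hZ z.2).1 G ⟨⟨_, hG.1⟩, hG.2⟩)
    rw [hker, this]
  let ψ := φ ∘ₗ LinearMap.mulLeft ℂ F
  have h5 := finrank_map_add_finrank_inf_ker ψ (homogeneousSubmodule (Fin (n + 1)) ℂ u)
  have h6 := hilbertFn_add_finrank_inf P u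
  have hkerψ : LinearMap.ker ψ = P.restrictScalars ℂ := by
    ext G
    rw [LinearMap.mem_ker, LinearMap.comp_apply, ← LinearMap.mem_ker, hker]
    exact ⟨fun h => (hP.mem_or_mem h).resolve_left hFP, fun h => P.mul_mem_left F h⟩
  rw [hkerψ] at h5
  have h7 : (homogeneousSubmodule (Fin (n + 1)) ℂ u).map ψ ≤ (N ⊓ LinearMap.ker E).map φ := by
    rintro _ ⟨G, hG, rfl⟩
    refine ⟨F * G, ⟨?_, ?_⟩, rfl⟩
    · rw [SetLike.mem_coe, mem_homogeneousSubmodule, add_comm u e]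
      exact hF.mul hG
    · refine funext fun z => ?_
      have := (vanishesAt_iff hF _).1 (mem_zeroLocus_singleton.1 (hZ z.2).2)
      rw [hE, map_mul, this, zero_mul]
      rfl
  have h8 := Submodule.finrank_mono h7
  rw [hsurj, finrank_top, finrank_fintype_fun_eq_card, Fintype.card_coe] at h1
  change _ + finrank ℂ ↥(N ⊓ P.restrictScalars ℂ) = finrank ℂ N at h2
  omega

theorem hilbertFn_add_mul_card_le [hP : P.IsPrime] {F : MvPolynomial (Fin (n + 1)) ℂ} {e : ℕ}
    (hF : F.IsHomogeneous e) (hFP : F ∉ P) {Z : Finset (Pt n)}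
    (hZ : (Z : Set (Pt n)) ⊆ projLocus P ∩ ZeroLocus {F}) (j : ℕ) :
    hilbertFn P Z.card + j * Z.card ≤ hilbertFn P (Z.card + j * e) := by
  induction j with
  | zero => simp
  | succ j ih =>
    have := hilbertFn_add_card_le hF hFP hZ (u := Z.card + j * e) (by omega)
    rw [add_assoc, ← Nat.succ_mul] at this
    rw [Nat.succ_mul]
    exact le_trans (by omega) this

theorem finite_inter_and_ncard_le [hP : P.IsPrime] {k c : ℕ}
    (hgrowth : ∀ u, hilbertFn P u ≤ k * u + c) {F : MvPolynomial (Fin (n + 1)) ℂ} {e : ℕ}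
    (hF : F.IsHomogeneous e) (hFP : F ∉ P) :
    (projLocus P ∩ ZeroLocus {F}).Finite ∧ (projLocus P ∩ ZeroLocus {F}).ncard ≤ k * e := by
  have hZ : ∀ Z : Finset (Pt n), (Z : Set (Pt n)) ⊆ projLocus P ∩ ZeroLocus {F} →
      Z.card ≤ k * e := fun Z hZ => by
    by_contra! hc
    have h1 := hilbertFn_add_mul_card_le hF hFP hZ (k * Z.card + c + 1)
    have h2 := hgrowth (Z.card + (k * Z.card + c + 1) * e)
    have h3 := Nat.mul_le_mul_left (k * Z.card + c + 1) (Nat.succ_le_of_lt hc)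
    have h4 : k * (Z.card + (k * Z.card + c + 1) * e) =
      k * Z.card + (k * Z.card + c + 1) * (k * e) := by ring
    rw [Nat.mul_succ] at h3
    omega
  have hfin : (projLocus P ∩ ZeroLocus {F}).Finite := by
    by_contra hinf
    obtain ⟨Z, hZsub, hZcard⟩ := Set.Infinite.exists_subset_card_eq hinf (k * e + 1)
    have := hZ Z hZsub
    omega
  refine ⟨hfin, ?_⟩
  rw [Set.ncard_eq_toFinset_card _ hfin]
  exact hZ _ (by simp)

theorem isCurve_projLocus [hP : P.IsPrime] (hl : l.IsHomogeneous 1) (hlP : l - 1 ∈ P)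
    (hM : M.IsHomogeneous 1) (hMP : ∀ a : ℂ, M - C a ∉ P) {k c : ℕ}
    (hgrowth : ∀ u, hilbertFn P u ≤ k * u + c) : IsCurve (projLocus P) := by
  refine ⟨isIrreducibleAlgSet_projLocus hl hlP, infinite_projLocus hl hlP hM hMP,
    fun A hA hAC hne => ?_⟩
  obtain ⟨F, d, hF, hFP, hFA⟩ := exists_form_of_not_projLocus_subset hl hlP hA
    fun h => hne (hAC.antisymm h)
  exact (finite_inter_and_ncard_le hgrowth hF hFP).1.subset (Set.subset_inter hAC hFA)

theorem exists_degree_projLocus [hP : P.IsPrime] (hl : l.IsHomogeneous 1) (hlP : l - 1 ∈ P)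
    (hM : M.IsHomogeneous 1) (hMP : ∀ a : ℂ, M - C a ∉ P) {k c : ℕ}
    (hgrowth : ∀ u, hilbertFn P u ≤ k * u + c) :
    ∃ d, 1 ≤ d ∧ IsCurveOfDegree (projLocus P) d ∧
      ∃ b, ∀ u, d * u ≤ hilbertFn P u + b := by
  have hcurve := isCurve_projLocus hl hlP hM hMP hgrowth
  let D : Set ℕ := {m | ∃ F : MvPolynomial (Fin (n + 1)) ℂ, F ≠ 0 ∧ F.IsHomogeneous 1 ∧
      ¬ projLocus P ⊆ ZeroLocus {F} ∧ (projLocus P ∩ ZeroLocus {F}).ncard = m}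
  have hfin : ∀ {F : MvPolynomial (Fin (n + 1)) ℂ}, F.IsHomogeneous 1 →
      ¬ projLocus P ⊆ ZeroLocus {F} → (projLocus P ∩ ZeroLocus {F}).Finite ∧
        (projLocus P ∩ ZeroLocus {F}).ncard ≤ k * 1 := fun hF h =>
    finite_inter_and_ncard_le hgrowth hF (mt (projLocus_subset_iff hl hlP hF).2 h)
  have hbdd : BddAbove D := by
    refine ⟨k * 1, ?_⟩
    rintro _ ⟨F, -, hF, hFC, rfl⟩
    exact (hfin hF hFC).2
  obtain ⟨x, hx, y, hy, hxy⟩ := hcurve.2.1.nontrivial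
  obtain ⟨F₁, hF₁, hF₁x, hF₁y⟩ := exists_linear_separating hxy
  have hF₁C : ¬ projLocus P ⊆ ZeroLocus {F₁} := fun h =>
    hF₁y (mem_zeroLocus_singleton.1 (h hy))
  have hF₁0 : F₁ ≠ 0 := by
    rintro rfl
    exact hF₁y fun _ _ _ => map_zero _
  have hmem : (projLocus P ∩ ZeroLocus {F₁}).ncard ∈ D := ⟨F₁, hF₁0, hF₁, hF₁C, rfl⟩
  have hpos : 0 < (projLocus P ∩ ZeroLocus {F₁}).ncard :=
    (Set.ncard_pos (hfin hF₁ hF₁C).1).2 ⟨x, hx, mem_zeroLocus_singleton.2 hF₁x⟩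
  have hmax : ∀ m ∈ D, m ≤ sSup D := fun m hm => le_csSup hbdd hm
  obtain ⟨F, hF0, hF, hFC, hFcard⟩ : sSup D ∈ D := Nat.sSup_mem ⟨_, hmem⟩ hbdd
  have hdeg : IsCurveOfDegree (projLocus P) (sSup D) :=
    ⟨hcurve, fun G hG0 hG hGC => hmax _ ⟨G, hG0, hG, hGC, rfl⟩, F, hF0, hF, hFC, hFcard⟩
  refine ⟨sSup D, hpos.trans_le (hmax _ hmem), hdeg, sSup D * sSup D, fun u => ?_⟩
  have hFP : F ∉ P := mt (projLocus_subset_iff hl hlP hF).2 hFC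
  have hZcard : (hfin hF hFC).1.toFinset.card = sSup D := by
    rw [← Set.ncard_eq_toFinset_card _ (hfin hF hFC).1, hFcard]
  have hiter := hilbertFn_add_mul_card_le hF hFP (Z := (hfin hF hFC).1.toFinset) (by simp)
    (u - sSup D)
  rw [hZcard, mul_one] at hiter
  rcases le_total (sSup D) u with h | h
  · rw [Nat.add_sub_cancel' h] at hiter
    have : sSup D * u = (u - sSup D) * sSup D + sSup D * sSup D := by
      rw [← Nat.add_mul, Nat.sub_add_cancel h, mul_comm]
    omega
  · exact (Nat.mul_le_mul_left _ h).trans (Nat.le_add_left _ _)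

end PrimeCurve

/-! ### The curves defined by an ideal of linear growth -/

section IdealCurves

open Module

variable {n : ℕ} {l M : MvPolynomial (Fin (n + 1)) ℂ}

theorem exists_homogenization (hl : l.IsHomogeneous 1) (g : MvPolynomial (Fin (n + 1)) ℂ) {e : ℕ}
    (he : g.totalDegree ≤ e) :
    ∃ H : MvPolynomial (Fin (n + 1)) ℂ, H.IsHomogeneous e ∧
      ∀ J : Ideal (MvPolynomial (Fin (n + 1)) ℂ), l - 1 ∈ J → (H ∈ J ↔ g ∈ J) := by
  let H := ∑ i ∈ Finset.range (g.totalDegree + 1), l ^ (e - i) * homogeneousComponent i g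
  refine ⟨H, ?_, fun J hJ => ?_⟩
  · refine IsHomogeneous.sum _ _ _ fun i hi => ?_
    have hi : i ≤ e := by
      have := Finset.mem_range.1 hi
      omega
    have := (hl.pow (e - i)).mul (homogeneousComponent_isHomogeneous i g)
    rwa [one_mul, Nat.sub_add_cancel hi] at this
  · have hsub : H - g ∈ J := by
      have h : H - g = ∑ i ∈ Finset.range (g.totalDegree + 1),
          (l ^ (e - i) - 1) * homogeneousComponent i g := by
        simp only [sub_mul, one_mul, Finset.sum_sub_distrib, sum_homogeneousComponent, H]
      rw [h]
      refine J.sum_mem fun i _ => J.mul_mem_right _ ?_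
      have hdvd := sub_dvd_pow_sub_pow l 1 (e - i)
      rw [one_pow] at hdvd
      exact J.mem_of_dvd hdvd hJ
    exact ⟨fun h => by simpa using J.sub_mem h hsub, fun h => by simpa using J.add_mem hsub h⟩

theorem sum_finrank_map_le_finrank_range {ι V U : Type*} [Fintype ι] {Q : ι → Type*}
    [AddCommGroup V] [Module ℂ V] [AddCommGroup U] [Module ℂ U] [∀ i, AddCommGroup (Q i)]
    [∀ i, Module ℂ (Q i)] (N : Submodule ℂ V) [FiniteDimensional ℂ N]
    (φ : (i : ι) → V →ₗ[ℂ] Q i) (Φ : (ι → N) →ₗ[ℂ] U)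
    (h : ∀ f, Φ f = 0 → ∀ i, φ i (f i) = 0) :
    ∑ i, finrank ℂ (N.map (φ i)) ≤ finrank ℂ (LinearMap.range Φ) := by
  let Ψ : (ι → N) →ₗ[ℂ] ((i : ι) → N.map (φ i)) :=
    LinearMap.pi fun i => (φ i).submoduleMap N ∘ₗ LinearMap.proj i
  have hker : LinearMap.ker Φ ≤ LinearMap.ker Ψ := fun f hf =>
    funext fun i => Subtype.ext (h f hf i)
  have hsurj : Function.Surjective Ψ := fun y => by
    choose x hx using fun i => (φ i).submoduleMap_surjective N (y i)
    exact ⟨x, funext hx⟩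
  have h1 := LinearMap.finrank_range_add_finrank_ker Φ
  have h2 := LinearMap.finrank_range_add_finrank_ker Ψ
  have h3 := Submodule.finrank_mono hker
  rw [LinearMap.range_eq_top.2 hsurj, finrank_top, Module.finrank_pi_fintype] at h2
  omega

theorem exists_sum_hilbertFn_le (hl : l.IsHomogeneous 1)
    {I : Ideal (MvPolynomial (Fin (n + 1)) ℂ)} (hlI : l - 1 ∈ I)
    {T : Finset (Ideal (MvPolynomial (Fin (n + 1)) ℂ))} (hprime : ∀ P ∈ T, P.IsPrime)
    (hI : ∀ P ∈ T, I ≤ P) (hanti : ∀ P ∈ T, ∀ Q ∈ T, Q ≤ P → Q = P) :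
    ∃ e, ∀ u, ∑ P ∈ T, hilbertFn P u ≤ hilbertFn I (u + e) := by
  classical
  have hg : ∀ P : T, ∃ g : MvPolynomial (Fin (n + 1)) ℂ,
      g ∉ P.1 ∧ ∀ Q ∈ T, Q ≠ P.1 → g ∈ Q := by
    rintro ⟨P, hP⟩
    by_contra! h
    have hle : (T.erase P).inf id ≤ P := fun g hgT => by
      by_contra hgP
      obtain ⟨Q, hQ, hQP, hgQ⟩ := h g hgP
      exact hgQ (Finset.inf_le (f := id) (Finset.mem_erase.2 ⟨hQP, hQ⟩) hgT)
    obtain ⟨Q, hQ, hQP⟩ := (hprime P hP).inf_le'.1 hle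
    exact (Finset.mem_erase.1 hQ).1 (hanti P hP Q (Finset.mem_erase.1 hQ).2 hQP)
  choose g hgP hgQ using hg
  let e := Finset.univ.sup fun P : T => (g P).totalDegree
  choose H hH hHmem using fun P : T => exists_homogenization hl (g P) (e := e)
    (Finset.le_sup (f := fun P : T => (g P).totalDegree) (Finset.mem_univ P))
  refine ⟨e, fun u => ?_⟩
  let V := homogeneousSubmodule (Fin (n + 1)) ℂ u
  let Φ : (T → V) →ₗ[ℂ] MvPolynomial (Fin (n + 1)) ℂ ⧸ I.restrictScalars ℂ :=
    ∑ P : T, ((I.restrictScalars ℂ).mkQ ∘ₗ LinearMap.mulRight ℂ (H P) ∘ₗ V.subtype) ∘ₗ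
      LinearMap.proj P
  have hΦ : ∀ f, Φ f = (I.restrictScalars ℂ).mkQ (∑ P : T, (f P).1 * H P) := fun f => by
    simp [Φ, LinearMap.sum_apply]
  have hrange : LinearMap.range Φ ≤
      (homogeneousSubmodule (Fin (n + 1)) ℂ (u + e)).map (I.restrictScalars ℂ).mkQ := by
    rintro _ ⟨f, rfl⟩
    rw [hΦ]
    exact ⟨_, Submodule.sum_mem _ fun P _ => (f P).2.mul (hH P), rfl⟩
  have hker : ∀ f, Φ f = 0 → ∀ Q : T, (Q.1.restrictScalars ℂ).mkQ (f Q).1 = 0 := fun f hf Q => by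
    rw [hΦ, ← LinearMap.mem_ker, Submodule.ker_mkQ] at hf
    rw [← LinearMap.mem_ker, Submodule.ker_mkQ]
    have hQl : l - 1 ∈ Q.1 := hI Q.1 Q.2 hlI
    have hf : ∑ P : T, (f P).1 * H P ∈ Q.1 := hI Q.1 Q.2 hf
    rw [← Finset.add_sum_erase _ _ (Finset.mem_univ Q)] at hf
    have hrest : ∑ P ∈ Finset.univ.erase Q, (f P).1 * H P ∈ Q.1 :=
      Q.1.sum_mem fun P hP => Q.1.mul_mem_left _ <| (hHmem P Q.1 hQl).2 <|
        hgQ P Q.1 Q.2 fun h => (Finset.mem_erase.1 hP).1 (Subtype.ext h.symm)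
    refine ((hprime Q.1 Q.2).mem_or_mem ((Q.1.add_mem_iff_left hrest).1 hf)).resolve_right ?_
    exact fun h => hgP Q ((hHmem Q Q.1 hQl).1 h)
  calc ∑ P ∈ T, hilbertFn P u = ∑ P : T, hilbertFn P.1 u :=
        (Finset.sum_coe_sort T fun P => hilbertFn P u).symm
    _ ≤ finrank ℂ (LinearMap.range Φ) := sum_finrank_map_le_finrank_range V
        (fun P : T => (P.1.restrictScalars ℂ).mkQ) Φ hker
    _ ≤ hilbertFn I (u + e) := Submodule.finrank_mono hrange

theorem exists_curves_of_ideal (hl : l.IsHomogeneous 1) (hM : M.IsHomogeneous 1)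
    {I : Ideal (MvPolynomial (Fin (n + 1)) ℂ)} (hlI : l - 1 ∈ I)
    (hMI : ∀ (a : ℂ) (F), (M - C a) * F ∈ I → F ∈ I) {k c : ℕ}
    (hgrowth : ∀ u, hilbertFn I u ≤ k * u + c) :
    ∃ (T : Finset (Ideal (MvPolynomial (Fin (n + 1)) ℂ)))
      (d : Ideal (MvPolynomial (Fin (n + 1)) ℂ) → ℕ),
      (∀ P ∈ T, 1 ≤ d P ∧ IsCurveOfDegree (projLocus P) (d P)) ∧ ∑ P ∈ T, d P ≤ k ∧
        ∀ v ∈ zeroLocus ℂ I, ∀ hv : v ≠ 0,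
          ∃ P ∈ T, Projectivization.mk ℂ v hv ∈ projLocus P := by
  have hfin := I.finite_minimalPrimes_of_isNoetherianRing
  have hT : ∀ {P}, P ∈ hfin.toFinset ↔ P ∈ I.minimalPrimes := hfin.mem_toFinset
  have hdeg : ∀ P, P ∈ I.minimalPrimes → ∃ d, 1 ≤ d ∧ IsCurveOfDegree (projLocus P) d ∧
      ∃ b, ∀ u, d * u ≤ hilbertFn P u + b := fun P hP => by
    have : P.IsPrime := hP.1.1
    refine exists_degree_projLocus hl (hP.1.2 hlI) hM (fun a ha => ?_)
      fun u => (hilbertFn_anti hP.1.2 u).trans (hgrowth u)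
    obtain ⟨y, hy, hMy⟩ := Ideal.exists_mul_mem_of_mem_minimalPrimes hP ha
    exact hy (hMI a y hMy)
  choose! d hd1 hd b hb using hdeg
  refine ⟨hfin.toFinset, d, fun P hP => ⟨hd1 P (hT.1 hP), hd P (hT.1 hP)⟩, ?_, fun v hv hv0 => ?_⟩
  · obtain ⟨e, he⟩ := exists_sum_hilbertFn_le hl hlI (T := hfin.toFinset)
      (fun P hP => (hT.1 hP).1.1) (fun P hP => (hT.1 hP).1.2)
      fun P hP Q hQ hQP => le_antisymm hQP ((hT.1 hP).2 (hT.1 hQ).1 hQP)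
    by_contra! hlt
    have hsum : ∀ u, (∑ P ∈ hfin.toFinset, d P) * u ≤
        k * (u + e) + c + ∑ P ∈ hfin.toFinset, b P := fun u => by
      have h1 : (∑ P ∈ hfin.toFinset, d P) * u ≤
          ∑ P ∈ hfin.toFinset, (hilbertFn P u + b P) := by
        rw [Finset.sum_mul]
        exact Finset.sum_le_sum fun P hP => hb P (hT.1 hP) u
      rw [Finset.sum_add_distrib] at h1
      have h2 := he u
      have h3 := hgrowth (u + e)
      omega
    have h1 := hsum (k * e + c + ∑ P ∈ hfin.toFinset, b P + 1)
    have h2 := Nat.mul_le_mul_right (k * e + c + ∑ P ∈ hfin.toFinset, b P + 1)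
      (Nat.succ_le_of_lt hlt)
    rw [Nat.succ_mul] at h2
    rw [mul_add k] at h1
    omega
  · have hprime : (vanishingIdeal ℂ ({v} : Set (Fin (n + 1) → ℂ))).IsPrime :=
      inferInstance
    obtain ⟨P, hP, hPv⟩ := Ideal.exists_minimalPrimes_le (I := I)
      (J := vanishingIdeal ℂ ({v} : Set (Fin (n + 1) → ℂ)))
      fun F hF => (mem_vanishingIdeal_singleton_iff v F).2 (hv F hF)
    exact ⟨P, hT.2 hP, mk_mem_projLocus hv0 fun F hF =>
      (mem_vanishingIdeal_singleton_iff v F).1 (hPv hF)⟩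

end IdealCurves

/-! ### Cayley–Bacharach sets -/

section Flat

open Module

variable {A : Type*} [CommRing A] [Algebra ℂ A] [FiniteDimensional ℂ A]

theorem exists_flat_pow [Nontrivial A] {W : Submodule ℂ A} (h1 : (1 : A) ∈ W) {μ : ℕ} (hμ : 2 ≤ μ)
    (hA : finrank ℂ A ≤ μ ^ 2 - 1) (hgen : ∃ u, W ^ u = ⊤) (hne : W ^ (2 * μ - 3) ≠ ⊤) :
    ∃ t, t + 1 ≤ 2 * μ - 3 ∧ finrank ℂ ↥(W ^ (t + 1)) ≤ finrank ℂ ↥(W ^ t) + (t + 1) ∧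
      finrank ℂ ↥(W ^ (t + 2)) + finrank ℂ ↥(W ^ t) = 2 * finrank ℂ ↥(W ^ (t + 1)) ∧
      finrank ℂ ↥(W ^ (t + 1)) - finrank ℂ ↥(W ^ t) ≤ μ - 1 ∧
      μ * (finrank ℂ ↥(W ^ (t + 1)) - finrank ℂ ↥(W ^ t)) < finrank ℂ A := by
  let r : ℕ → ℕ := fun u => finrank ℂ ↥(W ^ u)
  have hmono : Monotone r := monotone_nat_of_le_succ fun u =>
    Submodule.finrank_mono (pow_le_pow_succ_of_one_mem h1 u)
  have hr0 : r 0 = 1 := by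
    change finrank ℂ ↥(W ^ 0) = 1
    rw [pow_zero, Submodule.one_eq_span, finrank_span_singleton one_ne_zero]
  have hstep : ∀ u, r u ≤ r (u + 1) := fun u => hmono (Nat.le_succ u)
  have hsum : ∀ N, ∑ u ∈ Finset.range N, (r (u + 1) - r u) + 1 = r N := fun N => by
    rw [Finset.sum_range_tsub hmono, hr0]
    have := hmono (Nat.zero_le N)
    omega
  have htop : ∀ u, r u ≤ finrank ℂ A := fun u => Submodule.finrank_le _
  have hpos : 1 ≤ r (2 * μ - 3 + 1) - r (2 * μ - 3) := by
    by_contra hc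
    have hle : r (2 * μ - 3 + 1) ≤ r (2 * μ - 3) := by omega
    have heq : W ^ (2 * μ - 3) = W ^ (2 * μ - 3 + 1) :=
      Submodule.eq_of_le_of_finrank_le (pow_le_pow_succ_of_one_mem h1 _) hle
    have hstab : ∀ j, W ^ (2 * μ - 3 + j) = W ^ (2 * μ - 3) := fun j => by
      induction j with
      | zero => rfl
      | succ j ih => rw [← add_assoc, pow_succ, ih, ← pow_succ, ← heq]
    obtain ⟨u, hu⟩ := hgen
    have hle : W ^ u ≤ W ^ (2 * μ - 3 + u) :=
      monotone_nat_of_le_succ (pow_le_pow_succ_of_one_mem h1) (Nat.le_add_left _ _)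
    rw [hstab, hu, top_le_iff] at hle
    exact hne hle
  obtain ⟨t, ht, hgt, hflat, -, hle, hlt⟩ := exists_flat_step (g := fun u => r (u + 1) - r u) hμ
    (fun u hu => by
      have := finrank_pow_concave h1 (t := u) (by change r (u + 1) ≤ r u + (u + 1); omega)
      change r (u + 2) + r u ≤ 2 * r (u + 1) at this
      change r (u + 2) - r (u + 1) ≤ r (u + 1) - r u
      omega) hpos (by rw [hsum]; exact (htop _).trans hA)
  rw [hsum] at hlt
  change r (t + 2) - r (t + 1) = r (t + 1) - r t at hflat
  have e1 := hstep t
  have e2 := hstep (t + 1)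
  change r (t + 1) ≤ r (t + 2) at e2
  exact ⟨t, ht, by change r (t + 1) ≤ r t + (t + 1); omega,
    by change r (t + 2) + r t = 2 * r (t + 1); omega, hle, hlt.trans_le (htop _)⟩

end Flat

section CayleyBacharach

open Module

variable {n : ℕ}

/-- Every form of degree `D` vanishing at all points of `S` but possibly one vanishes on `S`. -/
def IsCayleyBacharach (S : Finset (Pt n)) (D : ℕ) : Prop :=
  ∀ P ∈ S, ∀ F : MvPolynomial (Fin (n + 1)) ℂ, F.IsHomogeneous D →
    (∀ Q ∈ S, Q ≠ P → VanishesAt F Q) → VanishesAt F P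

theorem exists_subset_isCayleyBacharach {S : Finset (Pt n)} {D : ℕ}
    (h : ¬ ImposesIndependentConditions S D) :
    ∃ S' ⊆ S, S'.Nonempty ∧ IsCayleyBacharach S' D := by
  classical
  induction S using Finset.strongInduction with
  | H S ih =>
  by_cases hCB : IsCayleyBacharach S D
  · refine ⟨S, Finset.Subset.rfl, Finset.nonempty_iff_ne_empty.2 fun h0 => h ?_, hCB⟩
    simp [h0, ImposesIndependentConditions]
  · unfold IsCayleyBacharach at hCB
    push Not at hCB
    obtain ⟨P, hP, F, hF, hFS, hFP⟩ := hCB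
    have hlt := Finset.erase_ssubset hP
    obtain ⟨S', hS', hS'ne, hS'CB⟩ := ih (S.erase P) hlt fun hind => h fun Q hQ => by
      by_cases hQP : Q = P
      · subst hQP
        exact ⟨F, hF, hFS, hFP⟩
      obtain ⟨G, hG, hGS, hGQ⟩ := hind Q (Finset.mem_erase.2 ⟨hQP, hQ⟩)
      have hFQ := hFS Q hQ hQP
      rw [vanishesAt_iff hF] at hFP hFQ
      rw [vanishesAt_iff hG] at hGQ
      have hH : (G - C (eval P.rep G / eval P.rep F) * F).IsHomogeneous D :=
        hG.sub (by simpa using (isHomogeneous_C _ (eval P.rep G / eval P.rep F)).mul hF)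
      refine ⟨_, hH, fun R hR hRQ => ?_, ?_⟩
      · rw [vanishesAt_iff hH]
        by_cases hRP : R = P
        · subst hRP
          simp [hFP]
        · have e1 := (vanishesAt_iff hG R).1 (hGS R (Finset.mem_erase.2 ⟨hRP, hR⟩) hRQ)
          have e2 := (vanishesAt_iff hF R).1 (hFS R hR hRP)
          simp [e1, e2]
      · rw [vanishesAt_iff hH]
        simpa [hFQ] using hGQ
    exact ⟨S', hS'.trans hlt.subset, hS'ne, hS'CB⟩

theorem exists_linear_forall_not_vanishesAt (S : Finset (Pt n)) :
    ∃ l : MvPolynomial (Fin (n + 1)) ℂ, l.IsHomogeneous 1 ∧ ∀ P ∈ S, ¬ VanishesAt l P := by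
  obtain ⟨f, hf⟩ := Module.exists_dual_forall_apply_ne_zero (K := ℂ)
    (fun P : S => P.1.rep) fun P => P.1.rep_nonzero
  have hl : (∑ i, C (f (Pi.single i 1)) * X i : MvPolynomial (Fin (n + 1)) ℂ).IsHomogeneous 1 :=
    IsHomogeneous.sum _ _ _ fun i _ => by
      simpa using (isHomogeneous_C _ (f (Pi.single i 1))).mul (isHomogeneous_X ℂ i)
  refine ⟨_, hl, fun P hP => ?_⟩
  rw [vanishesAt_iff hl]
  convert hf ⟨P, hP⟩
  conv_rhs => rw [pi_eq_sum_univ' P.rep]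
  simp [mul_comm]

/-- A Cayley–Bacharach set of at most `μ ^ 2 - 1` points lies on a union of curves whose degrees
are too small for the number of points. -/
theorem exists_curves_of_isCayleyBacharach {S : Finset (Pt n)} {μ : ℕ} (hμ : 2 ≤ μ)
    (hS : S.Nonempty) (hcard : S.card ≤ μ ^ 2 - 1) (hCB : IsCayleyBacharach S (2 * μ - 3)) :
    ∃ (T : Finset (Ideal (MvPolynomial (Fin (n + 1)) ℂ)))
      (d : Ideal (MvPolynomial (Fin (n + 1)) ℂ) → ℕ),
      (∀ P ∈ T, 1 ≤ d P ∧ IsCurveOfDegree (projLocus P) (d P)) ∧ ∑ P ∈ T, d P ≤ μ - 1 ∧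
        μ * ∑ P ∈ T, d P < S.card ∧ ∀ p ∈ S, ∃ P ∈ T, p ∈ projLocus P := by
  classical
  obtain ⟨l, hl, hlS⟩ := exists_linear_forall_not_vanishesAt S
  have : Nonempty S := hS.to_subtype
  let v : S → Fin (n + 1) → ℂ := fun p => normalizedRep l p.1
  let ev : MvPolynomial (Fin (n + 1)) ℂ →ₐ[ℂ] (S → ℂ) := aeval fun i p => v p i
  have hev : ∀ F p, ev F p = eval (v p) F := fun F p => by
    have : (Pi.evalAlgHom ℂ (fun _ : S => ℂ) p).comp ev = aeval (v p) :=
      MvPolynomial.algHom_ext fun i => by simp [ev]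
    exact DFunLike.congr_fun this F
  have hev0 : ∀ {u F}, F.IsHomogeneous u → ∀ p : S, ev F p = 0 ↔ VanishesAt F p.1 :=
    fun hF p => by rw [hev, eval_normalizedRep_eq_zero_iff hl (hlS p.1 p.2) hF]
  have hl1 : ev l = 1 := funext fun p => by
    rw [hev, eval_normalizedRep_self hl (hlS p.1 p.2)]
    rfl
  let W : Submodule ℂ (S → ℂ) := (homogeneousSubmodule (Fin (n + 1)) ℂ 1).map ev.toLinearMap
  have hW : ∀ u, W ^ u = (homogeneousSubmodule (Fin (n + 1)) ℂ u).map ev.toLinearMap := fun u => by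
    rw [← homogeneousSubmodule_one_pow, Submodule.map_pow]
  have h1 : (1 : S → ℂ) ∈ W := ⟨l, hl, hl1⟩
  have hsingle : ∀ p : S, ∃ G : MvPolynomial (Fin (n + 1)) ℂ, G.IsHomogeneous S.card ∧
      ∀ q, ev G q = (Pi.single p 1 : S → ℂ) q := fun p => by
    obtain ⟨G, hG, hGS, hGp⟩ := exists_form_separating S p.1 le_rfl
    rw [← hev0 hG p] at hGp
    refine ⟨(ev G p)⁻¹ • G, (homogeneousSubmodule _ ℂ _).smul_mem _ hG, fun q => ?_⟩
    by_cases hqp : q = p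
    · subst hqp
      simp [hGp]
    · have := (hev0 hG q).2 (hGS q.1 q.2 fun h => hqp (Subtype.ext h))
      simp [this, hqp]
  have hCB' : ∀ x ∈ W ^ (2 * μ - 3), ∀ p, (∀ q ≠ p, x q = 0) → x p = 0 := fun x hx p hxp => by
    rw [hW] at hx
    obtain ⟨F, hF, rfl⟩ := hx
    exact (hev0 hF p).2 (hCB p.1 p.2 F hF fun q hq hqp =>
      (hev0 hF ⟨q, hq⟩).1 (hxp ⟨q, hq⟩ fun h => hqp (congrArg Subtype.val h)))
  have hgen : W ^ S.card = ⊤ := by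
    rw [eq_top_iff, ← (Pi.basisFun ℂ S).span_eq, Submodule.span_le]
    rintro _ ⟨p, rfl⟩
    obtain ⟨G, hG, hGp⟩ := hsingle p
    rw [hW, Pi.basisFun_apply]
    exact ⟨G, hG, funext hGp⟩
  have hne : W ^ (2 * μ - 3) ≠ ⊤ := fun h => by
    obtain ⟨p⟩ := ‹Nonempty S›
    have := hCB' (Pi.single p 1) (h ▸ Submodule.mem_top) p fun q hq => by simp [hq]
    simp at this
  have hA : finrank ℂ (S → ℂ) = S.card := by
    rw [finrank_fintype_fun_eq_card, Fintype.card_coe]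
  obtain ⟨t, ht, hgt, hflat, hle, hlt⟩ := exists_flat_pow h1 hμ (hA.trans_le hcard) ⟨_, hgen⟩ hne
  obtain ⟨I, M, hM, c, hlI, hIW, hMI, hgrowth⟩ := exists_ideal_of_flat ev hl hl1 rfl hgt hflat
  obtain ⟨T, d, hT, hsum, hcover⟩ := exists_curves_of_ideal hl hM hlI hMI hgrowth
  refine ⟨T, d, hT, hsum.trans hle, ?_, fun p hp => ?_⟩
  · rw [hA] at hlt
    exact (Nat.mul_le_mul_left μ hsum).trans_lt hlt
  · have hWle : W ^ t ≤ W ^ (2 * μ - 3) :=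
      monotone_nat_of_le_succ (pow_le_pow_succ_of_one_mem h1) (by omega)
    have hv : v ⟨p, hp⟩ ∈ zeroLocus ℂ I := fun F hF => by
      obtain ⟨G, -, hG⟩ := hsingle ⟨p, hp⟩
      have := hCB' _ (hWle (hIW (G * F) (I.mul_mem_left G hF))) ⟨p, hp⟩ fun q hq => by
        rw [map_mul, Pi.mul_apply, hG, Pi.single_eq_of_ne hq, zero_mul]
      rw [map_mul, Pi.mul_apply, hG, Pi.single_eq_same, one_mul, hev] at this
      exact this
    have hlp := hlS p hp
    rw [vanishesAt_iff hl] at hlp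
    have hv0 : v ⟨p, hp⟩ ≠ 0 := smul_ne_zero (inv_ne_zero hlp) p.rep_nonzero
    obtain ⟨P, hP, hpP⟩ := hcover _ hv hv0
    refine ⟨P, hP, ?_⟩
    convert hpP
    conv_lhs => rw [← p.mk_rep]
    exact ((Projectivization.mk_eq_mk_iff' ℂ _ _ hv0 p.rep_nonzero).2 ⟨_, rfl⟩).symm

end CayleyBacharach

/-- Main theorem: a finite set of at most μ²-1 points in ℙⁿ (n ≥ 2) with at most μk points
on any curve of degree k (k = 1, …, μ-1) imposes independent linear conditions on forms
of degree 2μ-3. -/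
theorem main_independent_conditions (n μ : ℕ) (hn : 2 ≤ n) (hμ : 2 ≤ μ)
    (S₀ : Finset (Pt n)) (hcard : S₀.card ≤ μ ^ 2 - 1)
    (hcurves : ∀ k : ℕ, 1 ≤ k → k ≤ μ - 1 → ∀ C : Set (Pt n),
      IsCurveOfDegree C k → ((S₀ : Set (Pt n)) ∩ C).ncard ≤ μ * k) :
    ImposesIndependentConditions S₀ (2 * μ - 3) := by
  classical
  by_contra h
  obtain ⟨S, hS, hSne, hCB⟩ := exists_subset_isCayleyBacharach h
  obtain ⟨T, d, hT, hsum, hlt, hcover⟩ :=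
    exists_curves_of_isCayleyBacharach hμ hSne ((Finset.card_le_card hS).trans hcard) hCB
  have hle : S.card ≤ ∑ P ∈ T, (S₀.filter (· ∈ projLocus P)).card := by
    refine (Finset.card_le_card fun p hp => ?_).trans Finset.card_biUnion_le
    obtain ⟨P, hP, hpP⟩ := hcover p hp
    exact Finset.mem_biUnion.2 ⟨P, hP, Finset.mem_filter.2 ⟨hS hp, hpP⟩⟩
  have hbound : ∀ P ∈ T, (S₀.filter (· ∈ projLocus P)).card ≤ μ * d P := fun P hP => by
    have := hcurves (d P) (hT P hP).1
      ((Finset.single_le_sum (fun _ _ => Nat.zero_le _) hP).trans hsum) _ (hT P hP).2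
    rw [← Set.ncard_coe_finset, Finset.coe_filter]
    exact this
  have := hle.trans (Finset.sum_le_sum hbound)
  rw [← Finset.mul_sum] at this
  omega
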